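/- If G is a finite simple graph with mad(G) < 7, then τ(G) ≤ 2ν(G). -/

import Mathlib

open SimpleGraph

variable {V : Type*}

/-- `S` is a set of pairwise edge-disjoint triangles of `G` (two triangles, viewed as
3-element vertex sets, are edge-disjoint iff they share at most one vertex). -/
def EdgeDisjointTriangles [DecidableEq V] (G : SimpleGraph V) (S : Finset (Finset V)) : Prop :=
  (∀ t ∈ S, G.IsNClique 3 t) ∧
    ∀ t₁ ∈ S, ∀ t₂ ∈ S, t₁ ≠ t₂ → (t₁ ∩ t₂).card ≤ 1

/-- ν(G): the maximum size of a set of pairwise edge-disjoint triangles of `G`. -/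
noncomputable def triNu [DecidableEq V] (G : SimpleGraph V) : ℕ :=
  sSup {n | ∃ S : Finset (Finset V), EdgeDisjointTriangles G S ∧ S.card = n}

/-- τ(G): the minimum size of an edge set `Y` such that `G - Y` is triangle-free. -/
noncomputable def triTau [DecidableEq V] (G : SimpleGraph V) : ℕ :=
  sInf {n | ∃ Y : Finset (Sym2 V), ↑Y ⊆ G.edgeSet ∧
    (G.deleteEdges ↑Y).CliqueFree 3 ∧ Y.card = n}


lemma tau_le [Fintype V] [DecidableEq V] (G : SimpleGraph V) (Y : Finset (Sym2 V))
    (h : ∀ x y z, G.Adj x y → G.Adj y z → G.Adj x z → s(x,y) ∈ Y ∨ s(y,z) ∈ Y ∨ s(x,z) ∈ Y) :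
    triTau G ≤ Y.card := by
  classical
  have : triTau G ≤ (Y.filter (· ∈ G.edgeSet)).card := by
    apply Nat.sInf_le
    refine ⟨_, ?_, ?_, rfl⟩
    · intro e he; simp at he; exact he.2
    · intro t ht
      rw [is3Clique_iff] at ht
      obtain ⟨a, b, c, h1, h2, h3, -⟩ := ht
      simp only [deleteEdges_adj, Finset.coe_filter, Set.mem_ofPred_eq, mem_edgeSet, not_and] at h1 h2 h3
      have := h a b c h1.1 h3.1 h2.1
      tauto
  exact this.trans (Finset.card_filter_le _ _)

lemma tau_spec [Fintype V] [DecidableEq V] (G : SimpleGraph V) : ∃ Y : Finset (Sym2 V),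
    (∀ x y z, G.Adj x y → G.Adj y z → G.Adj x z → s(x,y) ∈ Y ∨ s(y,z) ∈ Y ∨ s(x,z) ∈ Y) ∧
    Y.card = triTau G := by
  classical
  have hne : {n | ∃ Y : Finset (Sym2 V), ↑Y ⊆ G.edgeSet ∧
    (G.deleteEdges ↑Y).CliqueFree 3 ∧ Y.card = n}.Nonempty := by
    refine ⟨_, G.edgeFinset, by simp, ?_, rfl⟩
    simp only [coe_edgeFinset, deleteEdges_edgeSet, sdiff_self]
    exact cliqueFree_bot (by norm_num)
  obtain ⟨Y, hY, hf, hc⟩ := Nat.sInf_mem hne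
  refine ⟨Y, ?_, hc⟩
  intro x y z h1 h2 h3
  by_contra! hh
  apply hf {x, y, z}
  rw [is3Clique_triple_iff]
  simp only [deleteEdges_adj]
  exact ⟨⟨h1, by simpa using hh.1⟩, ⟨h3, by simpa using hh.2.2⟩, ⟨h2, by simpa using hh.2.1⟩⟩

lemma nu_bdd [Fintype V] [DecidableEq V] (G : SimpleGraph V) :
    BddAbove {n | ∃ S : Finset (Finset V), EdgeDisjointTriangles G S ∧ S.card = n} := by
  refine ⟨Fintype.card (Finset V), ?_⟩
  rintro n ⟨S, -, rfl⟩
  exact Finset.card_le_univ S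

lemma le_nu [Fintype V] [DecidableEq V] (G : SimpleGraph V) (S : Finset (Finset V))
    (h : EdgeDisjointTriangles G S) : S.card ≤ triNu G :=
  le_csSup (nu_bdd G) ⟨S, h, rfl⟩

lemma nu_spec [Fintype V] [DecidableEq V] (G : SimpleGraph V) :
    ∃ S : Finset (Finset V), EdgeDisjointTriangles G S ∧ S.card = triNu G := by
  have : {n | ∃ S : Finset (Finset V), EdgeDisjointTriangles G S ∧ S.card = n}.Nonempty :=
    ⟨0, ∅, ⟨by simp, by simp⟩, rfl⟩
  exact Nat.sSup_mem this (nu_bdd G)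

/-- No reducible configuration. -/
def NoRed [DecidableEq V] (G : SimpleGraph V) : Prop :=
  ∀ (R Y : Finset (Sym2 V)) (S : Finset (Finset V)), (∃ e ∈ R, e ∈ G.edgeSet) →
    EdgeDisjointTriangles G S →
    (∀ t ∈ S, ∀ x ∈ t, ∀ y ∈ t, x ≠ y → s(x,y) ∈ R) → Y.card ≤ 2 * S.card →
    (∀ x y z, G.Adj x y → G.Adj y z → G.Adj x z → s(x,y) ∈ R →
      (s(x,y) ∈ Y ∨ s(y,z) ∈ Y ∨ s(x,z) ∈ Y)) → False

lemma noRed_of_min [Fintype V] [DecidableEq V] (G : SimpleGraph V)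
    (hG : ¬ triTau G ≤ 2 * triNu G) (ih : ∀ G' : SimpleGraph V, G' < G → triTau G' ≤ 2 * triNu G') :
    NoRed G := by
  classical
  intro R Y S ⟨e, heR, heG⟩ hS hSR hY hhit
  apply hG
  set G' := G.deleteEdges (↑(R ∪ Y) : Set (Sym2 V)) with hG'
  have hlt : G' < G := by
    refine lt_of_le_of_ne (deleteEdges_le _) ?_
    intro h
    rw [← h, hG', edgeSet_deleteEdges] at heG
    exact heG.2 (by simp [heR])
  have adj' : ∀ x y, G'.Adj x y ↔ G.Adj x y ∧ s(x,y) ∉ R ∧ s(x,y) ∉ Y := by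
    intro x y; simp [hG']
  obtain ⟨Y', hY', hYc⟩ := tau_spec G'
  obtain ⟨S', hS', hSc⟩ := nu_spec G'
  have h1 : triTau G ≤ (Y ∪ Y').card := by
    apply tau_le
    intro x y z hxy hyz hxz
    by_contra! hh
    simp only [Finset.mem_union, not_or] at hh
    obtain ⟨⟨a1, a2⟩, ⟨b1, b2⟩, c1, c2⟩ := hh
    by_cases r1 : s(x,y) ∈ R
    · have := hhit x y z hxy hyz hxz r1; tauto
    by_cases r2 : s(y,z) ∈ R
    · have := hhit y z x hyz hxz.symm hxy.symm r2
      rw [Sym2.eq_swap (a := z), Sym2.eq_swap (a := y) (b := x)] at this; tauto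
    by_cases r3 : s(x,z) ∈ R
    · have := hhit x z y hxz hyz.symm hxy r3
      rw [Sym2.eq_swap (a := z)] at this; tauto
    have := hY' x y z (by rw [adj']; tauto) (by rw [adj']; tauto) (by rw [adj']; tauto)
    tauto
  have hcross : ∀ t ∈ S, ∀ t' ∈ S', (t ∩ t').card ≤ 1 := by
    intro t ht t' ht'
    by_contra! hh
    obtain ⟨a, ha, b, hb, hab⟩ := Finset.one_lt_card.mp hh
    simp only [Finset.mem_inter] at ha hb
    have := (hS'.1 t' ht').1 ha.2 hb.2 hab
    rw [adj'] at this
    exact this.2.1 (hSR t ht a ha.1 b hb.1 hab)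
  have hdisj : Disjoint S S' := by
    rw [Finset.disjoint_left]
    intro t ht ht'
    have := hcross t ht t ht'
    rw [Finset.inter_self, (hS.1 t ht).2] at this
    omega
  have h2 : (S ∪ S').card ≤ triNu G := by
    apply le_nu
    constructor
    · intro t ht
      rcases Finset.mem_union.mp ht with h | h
      · exact hS.1 t h
      · exact (hS'.1 t h).mono hlt.le
    · intro t ht t' ht' hne
      rcases Finset.mem_union.mp ht with h | h <;> rcases Finset.mem_union.mp ht' with h' | h'
      · exact hS.2 t h t' h' hne
      · exact hcross t h t' h'
      · rw [Finset.inter_comm]; exact hcross t' h' t h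
      · exact hS'.2 t h t' h' hne
  rw [Finset.card_union_of_disjoint hdisj] at h2
  have h3 := Finset.card_union_le Y Y'
  have h4 := ih G' hlt
  omega

def inL (Y : List (ℕ × ℕ)) (i j : ℕ) : Bool := Y.any fun p => (p.1 == i && p.2 == j) || (p.1 == j && p.2 == i)

def okE (cl : List (ℕ × List ℕ)) (U Y : List (ℕ × ℕ)) (i j : ℕ) : Bool :=
  inL Y i j || cl.any fun p => p.1 == i && p.2.all fun k => k == j || inL Y i k || inL Y j k || inL U j k

def okE2 (cl : List (ℕ × List ℕ)) (U Y : List (ℕ × ℕ)) (i j : ℕ) : Bool := okE cl U Y i j || okE cl U Y j i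

def tri (t : ℕ × ℕ × ℕ) : Finset ℕ := {t.1, t.2.1, t.2.2}

def chk (n : ℕ) (E : List (ℕ × ℕ)) (S : List (ℕ × ℕ × ℕ)) (Y : List (ℕ × ℕ))
    (cl : List (ℕ × List ℕ)) (U : List (ℕ × ℕ)) : Prop :=
  S ≠ [] ∧ Y.length ≤ 2 * S.length ∧ S.Pairwise (fun s t => (tri s ∩ tri t).card ≤ 1) ∧
  ∀ t ∈ S, (tri t).card = 3 ∧ ∀ i ∈ tri t, i < n ∧ ∀ j ∈ tri t, i ≠ j →
    inL E i j = true ∧ okE2 cl U Y i j = true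

instance (n : ℕ) (E : List (ℕ × ℕ)) (S : List (ℕ × ℕ × ℕ)) (Y : List (ℕ × ℕ))
    (cl : List (ℕ × List ℕ)) (U : List (ℕ × ℕ)) : Decidable (chk n E S Y cl U) := by
  unfold chk; infer_instance

lemma inL_iff (Y : List (ℕ × ℕ)) (i j : ℕ) : inL Y i j = true ↔ (i,j) ∈ Y ∨ (j,i) ∈ Y := by
  unfold inL
  rw [List.any_eq_true]
  constructor
  · rintro ⟨⟨a,b⟩, h, h'⟩
    simp at h'
    rcases h' with ⟨rfl, rfl⟩ | ⟨rfl, rfl⟩ <;> tauto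
  · rintro (h | h)
    · exact ⟨_, h, by simp⟩
    · exact ⟨_, h, by simp⟩

lemma tmpl [DecidableEq V] {G : SimpleGraph V} (hG : NoRed G) (d : V) (vs : List V)
    (E : List (ℕ × ℕ)) (S : List (ℕ × ℕ × ℕ)) (Y : List (ℕ × ℕ))
    (cl : List (ℕ × List ℕ)) (U : List (ℕ × ℕ)) (hc : chk vs.length E S Y cl U)
    (hnd : vs.Nodup) (hE : ∀ p ∈ E, G.Adj (vs.getD p.1 d) (vs.getD p.2 d))
    (hcl : ∀ p ∈ cl, ∀ z, G.Adj (vs.getD p.1 d) z → ∃ k ∈ p.2, z = vs.getD k d)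
    (hU : ∀ p ∈ U, ¬ G.Adj (vs.getD p.1 d) (vs.getD p.2 d)) : False := by
  classical
  obtain ⟨hS0, hlen, hpw, hall⟩ := hc
  set f : ℕ → V := fun i => vs.getD i d with hf
  have hinj : ∀ i j, i < vs.length → j < vs.length → f i = f j → i = j := by
    intro i j hi hj h
    simp only [hf, List.getD_eq_getElem _ _ hi, List.getD_eq_getElem _ _ hj] at h
    exact (List.Nodup.getElem_inj_iff hnd).mp h
  have hlt : ∀ t ∈ S, ∀ i ∈ tri t, i < vs.length := fun t ht i hi => ((hall t ht).2 i hi).1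
  have hE' : ∀ i j, inL E i j = true → G.Adj (f i) (f j) := by
    intro i j h
    rw [inL_iff] at h
    rcases h with h | h
    · exact hE _ h
    · exact (hE _ h).symm
  have hU' : ∀ i j, inL U i j = true → ¬ G.Adj (f i) (f j) := by
    intro i j h
    rw [inL_iff] at h
    rcases h with h | h
    · exact hU _ h
    · exact fun h' => hU _ h h'.symm
  set YF : Finset (Sym2 V) := (Y.map fun p => s(f p.1, f p.2)).toFinset with hYF
  have hYm : ∀ i j, inL Y i j = true → s(f i, f j) ∈ YF := by
    intro i j h
    rw [inL_iff] at h
    rw [hYF, List.mem_toFinset, List.mem_map]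
    rcases h with h | h
    · exact ⟨_, h, rfl⟩
    · exact ⟨_, h, Sym2.eq_swap⟩
  set SL : List (Finset V) := S.map fun t => (tri t).image f with hSL
  have hcard : ∀ t ∈ S, ((tri t).image f).card = 3 := by
    intro t ht
    rw [Finset.card_image_of_injOn, (hall t ht).1]
    intro i hi j hj h
    exact hinj i j (hlt t ht i hi) (hlt t ht j hj) h
  have hSpw : SL.Pairwise fun s t => (s ∩ t).card ≤ 1 := by
    rw [hSL, List.pairwise_map]
    refine List.Pairwise.imp_of_mem ?_ hpw
    intro s t hs ht h
    refine le_trans ?_ h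
    refine le_trans (Finset.card_le_card ?_) (Finset.card_image_le (f := f))
    intro x hx
    simp only [Finset.mem_inter, Finset.mem_image] at hx ⊢
    obtain ⟨⟨i, hi, rfl⟩, j, hj, hji⟩ := hx
    have := hinj j i (hlt t ht j hj) (hlt s hs i hi) hji
    subst this
    exact ⟨j, ⟨hi, hj⟩, rfl⟩
  have hSnd : SL.Nodup := by
    refine List.Pairwise.imp_of_mem ?_ hSpw
    intro s t hs ht h hst
    subst hst
    rw [hSL, List.mem_map] at hs
    obtain ⟨t, ht', rfl⟩ := hs
    rw [Finset.inter_self, hcard t ht'] at h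
    omega
  have hsym : Std.Symm fun s t : Finset V => (s ∩ t).card ≤ 1 := by
    constructor
    intro s t h
    rw [Finset.inter_comm]; exact h
  set RF : Finset (Sym2 V) := (S.flatMap fun t => [s(f t.1, f t.2.1), s(f t.2.1, f t.2.2), s(f t.1, f t.2.2)]).toFinset with hRF
  have hokE : ∀ i j z, okE cl U Y i j = true → G.Adj (f i) (f j) → G.Adj (f j) z → G.Adj (f i) z →
      s(f i, f j) ∈ YF ∨ s(f j, z) ∈ YF ∨ s(f i, z) ∈ YF := by
    intro i j z h h1 h2 h3
    unfold okE at h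
    rw [Bool.or_eq_true, List.any_eq_true] at h
    rcases h with h | ⟨⟨p, l⟩, hp, h⟩
    · exact Or.inl (hYm _ _ h)
    · simp only [Bool.and_eq_true, beq_iff_eq, List.all_eq_true, Bool.or_eq_true] at h
      obtain ⟨rfl, h⟩ := h
      obtain ⟨k, hk, rfl⟩ := hcl _ hp z h3
      rcases h k hk with ((h | h) | h) | h
      · subst h; exact absurd h2 (G.irrefl)
      · exact Or.inr (Or.inr (hYm _ _ h))
      · exact Or.inr (Or.inl (hYm _ _ h))
      · exact absurd h2 (hU' _ _ h)
  have hok2 : ∀ i j z, okE2 cl U Y i j = true → G.Adj (f i) (f j) → G.Adj (f j) z → G.Adj (f i) z →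
      s(f i, f j) ∈ YF ∨ s(f j, z) ∈ YF ∨ s(f i, z) ∈ YF := by
    intro i j z h h1 h2 h3
    unfold okE2 at h
    rw [Bool.or_eq_true] at h
    rcases h with h | h
    · exact hokE i j z h h1 h2 h3
    · have := hokE j i z h h1.symm h3 h2
      rw [Sym2.eq_swap] at this; tauto
  have htm : ∀ t : ℕ × ℕ × ℕ, t.1 ∈ tri t ∧ t.2.1 ∈ tri t ∧ t.2.2 ∈ tri t := by
    intro t; simp [tri]
  have hne3 : ∀ t ∈ S, t.1 ≠ t.2.1 ∧ t.2.1 ≠ t.2.2 ∧ t.1 ≠ t.2.2 := by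
    intro t ht
    have h := (hall t ht).1
    unfold tri at h
    refine ⟨?_, ?_, ?_⟩ <;> intro h' <;> rw [h'] at h
    · have := Finset.card_le_two (a := t.2.1) (b := t.2.2); simp at h; omega
    · have := Finset.card_le_two (a := t.1) (b := t.2.2); simp at h; omega
    · have := Finset.card_le_two (a := t.2.1) (b := t.2.2); simp at h; omega
  refine hG RF YF SL.toFinset ?_ ?_ ?_ ?_ ?_
  · obtain ⟨t, ht⟩ := List.exists_mem_of_ne_nil S hS0
    refine ⟨s(f t.1, f t.2.1), ?_, ?_⟩
    · rw [hRF, List.mem_toFinset, List.mem_flatMap]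
      exact ⟨t, ht, by simp⟩
    · exact hE' _ _ (((hall t ht).2 _ (htm t).1).2 _ (htm t).2.1 (hne3 t ht).1).1
  · constructor
    · intro t ht
      rw [hSL, List.mem_toFinset, List.mem_map] at ht
      obtain ⟨t, ht, rfl⟩ := ht
      refine ⟨?_, hcard t ht⟩
      intro x hx y hy hxy
      simp only [Finset.coe_image, Set.mem_image, Finset.mem_coe] at hx hy
      obtain ⟨i, hi, rfl⟩ := hx
      obtain ⟨j, hj, rfl⟩ := hy
      exact hE' _ _ (((hall t ht).2 _ hi).2 _ hj (fun h => hxy (h ▸ rfl))).1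
    · intro s hs t ht hne
      rw [List.mem_toFinset] at hs ht
      exact hSpw.forall (R := fun s t : Finset V => (s ∩ t).card ≤ 1) hs ht hne
  · intro t ht x hx y hy hxy
    rw [hSL, List.mem_toFinset, List.mem_map] at ht
    obtain ⟨t, ht, rfl⟩ := ht
    rw [hRF, List.mem_toFinset, List.mem_flatMap]
    refine ⟨t, ht, ?_⟩
    simp only [tri, Finset.image_insert, Finset.image_singleton, Finset.mem_insert, Finset.mem_singleton] at hx hy
    rcases hx with rfl | rfl | rfl <;> rcases hy with rfl | rfl | rfl <;> simp at hxy ⊢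
  · rw [List.toFinset_card_of_nodup hSnd, hSL, List.length_map]
    refine le_trans (List.toFinset_card_le _) ?_
    rw [List.length_map]; exact hlen
  · intro x y z h1 h2 h3 hR
    rw [hRF, List.mem_toFinset, List.mem_flatMap] at hR
    obtain ⟨t, ht, hR⟩ := hR
    have key : ∀ i j, i ∈ tri t → j ∈ tri t → i ≠ j → s(x,y) = s(f i, f j) →
        s(x,y) ∈ YF ∨ s(y,z) ∈ YF ∨ s(x,z) ∈ YF := by
      intro i j hi hj hij hxy
      have hk := (((hall t ht).2 i hi).2 j hj hij).2
      rw [Sym2.eq_iff] at hxy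
      rcases hxy with ⟨rfl, rfl⟩ | ⟨rfl, rfl⟩
      · exact hok2 i j z hk h1 h2 h3
      · have := hok2 i j z hk h1.symm h3 h2
        rw [Sym2.eq_swap] at this; tauto
    simp only [List.mem_cons, List.not_mem_nil, or_false] at hR
    obtain ⟨n1, n2, n3⟩ := hne3 t ht
    obtain ⟨m1, m2, m3⟩ := htm t
    rcases hR with h | h | h
    · exact key _ _ m1 m2 n1 h
    · exact key _ _ m2 m3 n2 h
    · exact key _ _ m1 m3 n3 h


lemma exp_aux [DecidableEq V] {G : SimpleGraph V} (hG : NoRed G) (w : V) (n : ℕ) :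
    ∀ (I J : Finset V), I.card = n → I.Nonempty → (∀ i ∈ I, G.Adj w i) →
    (∀ i ∈ I, ∀ j ∈ I, ¬ G.Adj i j) → (∀ i ∈ I, ∀ z, G.Adj w z → G.Adj i z → z ∈ J) →
    I.card < J.card := by
  classical
  induction n using Nat.strong_induction_on with
  | _ n ih =>
  intro I J hn hne hIw hind hJ
  by_contra hlt
  set J0 := J.filter (fun z => G.Adj w z ∧ ∃ i ∈ I, G.Adj i z) with hJ0
  have hJ0c : J0.card ≤ I.card := (Finset.card_filter_le _ _).trans (not_lt.mp hlt)
  have hJm : ∀ i ∈ I, ∀ z, G.Adj w z → G.Adj i z → z ∈ J0 := by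
    intro i hi z h1 h2
    simp only [hJ0, Finset.mem_filter]
    exact ⟨hJ i hi z h1 h2, h1, i, hi, h2⟩
  have hJw : ∀ j ∈ J0, G.Adj w j ∧ ∃ i ∈ I, G.Adj i j := by
    intro j hj
    simp only [hJ0, Finset.mem_filter] at hj
    exact hj.2
  have hJI : ∀ j ∈ J0, j ∉ I := by
    intro j hj hjI
    obtain ⟨-, i, hi, hij⟩ := hJw j hj
    exact hind i hi j hjI hij
  by_cases hall : ∀ X : Finset {x // x ∈ J0}, X.card ≤ (X.biUnion fun j => I.filter (G.Adj j.1)).card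
  · rw [Finset.all_card_le_biUnion_card_iff_exists_injective] at hall
    obtain ⟨m0, hm0, hm0'⟩ := hall
    set m : V → V := fun j => if h : j ∈ J0 then m0 ⟨j, h⟩ else j with hm
    have hmi : ∀ j ∈ J0, ∀ j' ∈ J0, m j = m j' → j = j' := by
      intro j hj j' hj' h
      simp only [hm, hj, hj', dif_pos] at h
      have := hm0 h
      simpa using this
    have hmI : ∀ j ∈ J0, m j ∈ I ∧ G.Adj j (m j) := by
      intro j hj
      have := hm0' ⟨j, hj⟩
      simp only [hm, hj, dif_pos]
      simpa using this
    have hwI : w ∉ I := fun h => G.irrefl (hIw w h)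
    have hwJ : w ∉ J0 := fun h => G.irrefl (hJw w h).1
    have hint : ∀ j ∈ J0, ∀ j' ∈ J0, j ≠ j' → (({w, j, m j} : Finset V) ∩ {w, j', m j'}).card ≤ 1 := by
      intro j hj j' hj' hne'
      have : (({w, j, m j} : Finset V) ∩ {w, j', m j'}) ⊆ {w} := by
        intro x hx
        simp only [Finset.mem_inter, Finset.mem_insert, Finset.mem_singleton] at hx ⊢
        have a1 := hmi j hj j' hj'
        have a2 := hJI j hj
        have a3 := hJI j' hj'
        have a4 := (hmI j hj).1
        have a5 := (hmI j' hj').1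
        grind
      exact (Finset.card_le_card this).trans (by simp)
    have hc3 : ∀ j ∈ J0, ({w, j, m j} : Finset V).card = 3 := by
      intro j hj
      rw [Finset.card_eq_three]
      refine ⟨w, j, m j, (hJw j hj).1.ne, ?_, (hmI j hj).2.ne, rfl⟩
      intro h; exact hwI (h ▸ (hmI j hj).1)
    have hScard : (J0.image fun j => ({w, j, m j} : Finset V)).card = J0.card := by
      apply Finset.card_image_of_injOn
      intro j hj j' hj' h
      by_contra hne'
      have h1 := hint j hj j' hj' hne'
      simp only at h
      rw [← h, Finset.inter_self, hc3 j hj] at h1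
      omega
    refine hG (I.image (fun i => s(w,i)) ∪ (J0.image (fun j => s(w,j)) ∪ J0.image fun j => s(j, m j)))
      (J0.image (fun j => s(w,j)) ∪ J0.image fun j => s(j, m j))
      (J0.image fun j => {w, j, m j}) ?_ ?_ ?_ ?_ ?_
    · obtain ⟨i, hi⟩ := hne
      exact ⟨s(w,i), Finset.mem_union_left _ (Finset.mem_image_of_mem _ hi), hIw i hi⟩
    · constructor
      · intro t ht
        obtain ⟨j, hj, rfl⟩ := Finset.mem_image.mp ht
        rw [is3Clique_triple_iff]
        exact ⟨(hJw j hj).1, hIw _ (hmI j hj).1, (hmI j hj).2⟩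
      · intro t ht t' ht' hne'
        obtain ⟨j, hj, rfl⟩ := Finset.mem_image.mp ht
        obtain ⟨j', hj', rfl⟩ := Finset.mem_image.mp ht'
        exact hint j hj j' hj' (fun h => hne' (by rw [h]))
    · intro t ht x hx y hy hxy
      obtain ⟨j, hj, rfl⟩ := Finset.mem_image.mp ht
      have b1 : s(w, j) ∈ J0.image (fun j => s(w,j)) := Finset.mem_image_of_mem _ hj
      have b2 : s(j, m j) ∈ J0.image (fun j => s(j, m j)) := Finset.mem_image_of_mem (fun j => s(j, m j)) hj
      have b3 : s(w, m j) ∈ I.image (fun j => s(w,j)) := Finset.mem_image_of_mem _ (hmI j hj).1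
      simp only [Finset.mem_insert, Finset.mem_singleton] at hx hy
      simp only [Finset.mem_union]
      rcases hx with rfl | rfl | rfl <;> rcases hy with rfl | rfl | rfl <;>
        first
        | exact absurd rfl hxy
        | tauto
        | (rw [Sym2.eq_swap]; tauto)
    · rw [hScard]
      refine (Finset.card_union_le _ _).trans ?_
      have := Finset.card_image_le (s := J0) (f := fun j => s(w,j))
      have := Finset.card_image_le (s := J0) (f := fun j => s(j, m j))
      omega
    · intro x y z h1 h2 h3 hR
      rw [Finset.mem_union] at hR
      rcases hR with hR | hR
      · obtain ⟨i, hi, hxy⟩ := Finset.mem_image.mp hR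
        rw [Sym2.eq_iff] at hxy
        rcases hxy with ⟨rfl, rfl⟩ | ⟨rfl, rfl⟩
        · right; right
          exact Finset.mem_union_left _ (Finset.mem_image_of_mem _ (hJm _ hi z h3 h2))
        · right; left
          exact Finset.mem_union_left _ (Finset.mem_image_of_mem _ (hJm _ hi z h2 h3))
      · exact Or.inl hR
  · push Not at hall
    obtain ⟨X, hX⟩ := hall
    set N := X.biUnion fun j => I.filter (G.Adj j.1) with hN
    set X' := X.image Subtype.val with hX'
    have hX'c : X'.card = X.card := Finset.card_image_of_injective _ Subtype.val_injective
    have hX'J : X' ⊆ J0 := by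
      intro x hx
      obtain ⟨y, -, rfl⟩ := Finset.mem_image.mp hx
      exact y.2
    have hNI : N ⊆ I := by
      intro x hx
      simp only [hN, Finset.mem_biUnion, Finset.mem_filter] at hx
      obtain ⟨_, _, h, _⟩ := hx
      exact h
    have hc1 := Finset.card_sdiff_of_subset hNI
    have hc2 := Finset.card_sdiff_of_subset hX'J
    have hc3 := Finset.card_le_card hNI
    have hc4 := Finset.card_le_card hX'J
    have hNpos : 0 < N.card := by
      have : 0 < X.card := by omega
      obtain ⟨x, hx⟩ := Finset.card_pos.mp this
      obtain ⟨-, i, hi, hij⟩ := hJw x.1 x.2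
      apply Finset.card_pos.mpr
      refine ⟨i, ?_⟩
      simp only [hN, Finset.mem_biUnion, Finset.mem_filter]
      exact ⟨x, hx, hi, hij.symm⟩
    have := ih (I \ N).card (by omega) (I \ N) (J0 \ X') rfl (Finset.card_pos.mp (by omega))
      (fun i hi => hIw i (Finset.mem_sdiff.mp hi).1)
      (fun i hi j hj => hind i (Finset.mem_sdiff.mp hi).1 j (Finset.mem_sdiff.mp hj).1) (by
        intro i hi z h1 h2
        rw [Finset.mem_sdiff] at hi ⊢
        refine ⟨hJm i hi.1 z h1 h2, ?_⟩
        intro hz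
        apply hi.2
        obtain ⟨y, hy, rfl⟩ := Finset.mem_image.mp hz
        simp only [hN, Finset.mem_biUnion, Finset.mem_filter]
        exact ⟨y, hy, hi.1, h2.symm⟩)
    omega

lemma exp_l [DecidableEq V] {G : SimpleGraph V} (hG : NoRed G) (w : V) (I J : List V) (hnd : I.Nodup)
    (hne : I ≠ []) (hIw : ∀ i ∈ I, G.Adj w i)
    (hind : ∀ i ∈ I, ∀ j ∈ I, ¬ G.Adj i j) (hJ : ∀ i ∈ I, ∀ z, G.Adj w z → G.Adj i z → z ∈ J) :
    I.length < J.length := by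
  have := exp_aux hG w _ I.toFinset J.toFinset rfl (by simpa [List.toFinset_nonempty_iff] using hne)
    (by simpa using hIw) (by simpa using hind) (by simpa using hJ)
  rw [List.toFinset_card_of_nodup hnd] at this
  exact this.trans_le (List.toFinset_card_le _)


lemma fn {α : Type*} {p : α → Prop} : ∀ x ∈ ([] : List α), p x := fun _ h => absurd h List.not_mem_nil
lemma fc {α : Type*} {p : α → Prop} {a : α} {l : List α} (h1 : p a) (h2 : ∀ x ∈ l, p x) : ∀ x ∈ a :: l, p x :=
  List.forall_mem_cons.2 ⟨h1, h2⟩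
lemma tmpl' [DecidableEq V] {G : SimpleGraph V} (hG : NoRed G) (d : V) (vs : List V)
    (E : List (ℕ × ℕ)) (S : List (ℕ × ℕ × ℕ)) (Y : List (ℕ × ℕ))
    (cl : List (ℕ × List ℕ)) (U : List (ℕ × ℕ)) (n : ℕ) (hn : vs.length = n) (hc : chk n E S Y cl U)
    (hnd : vs.Nodup) (hE : ∀ p ∈ E, G.Adj (vs.getD p.1 d) (vs.getD p.2 d))
    (hcl : ∀ p ∈ cl, ∀ z, G.Adj (vs.getD p.1 d) z → ∃ k ∈ p.2, z = vs.getD k d)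
    (hU : ∀ p ∈ U, ¬ G.Adj (vs.getD p.1 d) (vs.getD p.2 d)) : False := by
  subst hn
  exact tmpl hG d vs E S Y cl U hc hnd hE hcl hU

lemma T_3 [DecidableEq V] {G : SimpleGraph V} (hG : NoRed G) {v a b c : V} (hnd : [v,a,b,c].Nodup)
    (clv : ∀ k, G.Adj v k ↔ k ∈ [a,b,c])
    (hab : G.Adj a b) : False := by
  refine tmpl' hG v [v,a,b,c] [(0,1),(1,2),(0,2)] [(0,1,2)] [(1,2),(0,3)]
    [(0,[1,2,3])] [] 4 rfl (by decide +kernel) hnd ?_ ?_ ?_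
  · exact fc ((clv a).2 (by simp)) (fc (hab) (fc ((clv b).2 (by simp)) (fn)))
  · exact fc (fun z hz => by simpa using (clv z).1 hz) (fn)
  · exact fn

lemma T_4 [DecidableEq V] {G : SimpleGraph V} (hG : NoRed G) {v a b c d : V} (hnd : [v,a,b,c,d].Nodup)
    (clv : ∀ k, G.Adj v k ↔ k ∈ [a,b,c,d])
    (hab : G.Adj a b) (hcd : G.Adj c d) : False := by
  refine tmpl' hG v [v,a,b,c,d] [(0,1),(1,2),(0,2),(0,3),(3,4),(0,4)] [(0,1,2),(0,3,4)] [(1,2),(3,4),(0,1),(0,2)]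
    [(0,[1,2,3,4])] [] 5 rfl (by decide +kernel) hnd ?_ ?_ ?_
  · exact fc ((clv a).2 (by simp)) (fc (hab) (fc ((clv b).2 (by simp)) (fc ((clv c).2 (by simp)) (fc (hcd) (fc ((clv d).2 (by simp)) (fn))))))
  · exact fc (fun z hz => by simpa using (clv z).1 hz) (fn)
  · exact fn

lemma T_5 [DecidableEq V] {G : SimpleGraph V} (hG : NoRed G) {v a b c x y : V} (hnd : [v,a,b,c,x,y].Nodup)
    (clv : ∀ k, G.Adj v k ↔ k ∈ [a,b,c,x,y])
    (hac : G.Adj a c) (hbx : G.Adj b x) (nab : ¬ G.Adj a b) (nbc : ¬ G.Adj b c) : False := by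
  refine tmpl' hG v [v,a,b,c,x,y] [(0,1),(1,3),(0,3),(0,2),(2,4),(0,4)] [(0,1,3),(0,2,4)] [(1,3),(2,4),(0,4),(0,5)]
    [(0,[1,2,3,4,5])] [(1,2),(2,3)] 6 rfl (by decide +kernel) hnd ?_ ?_ ?_
  · exact fc ((clv a).2 (by simp)) (fc (hac) (fc ((clv c).2 (by simp)) (fc ((clv b).2 (by simp)) (fc (hbx) (fc ((clv x).2 (by simp)) (fn))))))
  · exact fc (fun z hz => by simpa using (clv z).1 hz) (fn)
  · exact fc (nab) (fc (nbc) (fn))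

lemma T_5b [DecidableEq V] {G : SimpleGraph V} (hG : NoRed G) {v w x a b c : V} (hnd : [v,w,x,a,b,c].Nodup)
    (clv : ∀ k, G.Adj v k ↔ k ∈ [w,x,a,b,c])
    (hxa : G.Adj x a) (hac : G.Adj a c) (hxc : G.Adj x c) (hwa : G.Adj w a) (hwb : G.Adj w b) (hbc : G.Adj b c) (hwc : G.Adj w c) (hxb : G.Adj x b) (nwx : ¬ G.Adj w x) (nab : ¬ G.Adj a b) : False := by
  refine tmpl' hG v [v,w,x,a,b,c] [(2,3),(3,5),(2,5),(0,1),(1,3),(0,3),(1,4),(4,5),(1,5),(0,2),(2,4),(0,4)] [(2,3,5),(0,1,3),(1,4,5),(0,2,4)] [(3,5),(3,1),(3,2),(4,5),(4,1),(4,2),(5,1),(5,2)]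
    [(0,[1,2,3,4,5])] [(1,2),(3,4)] 6 rfl (by decide +kernel) hnd ?_ ?_ ?_
  · exact fc (hxa) (fc (hac) (fc (hxc) (fc ((clv w).2 (by simp)) (fc (hwa) (fc ((clv a).2 (by simp)) (fc (hwb) (fc (hbc) (fc (hwc) (fc ((clv x).2 (by simp)) (fc (hxb) (fc ((clv b).2 (by simp)) (fn))))))))))))
  · exact fc (fun z hz => by simpa using (clv z).1 hz) (fn)
  · exact fc (nwx) (fc (nab) (fn))

lemma T_6a [DecidableEq V] {G : SimpleGraph V} (hG : NoRed G) {v a b c x y z : V} (hnd : [v,a,b,c,x,y,z].Nodup)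
    (clv : ∀ k, G.Adj v k ↔ k ∈ [a,b,c,x,y,z])
    (hac : G.Adj a c) (hbx : G.Adj b x) (hyz : G.Adj y z) (nab : ¬ G.Adj a b) (nbc : ¬ G.Adj b c) : False := by
  refine tmpl' hG v [v,a,b,c,x,y,z] [(0,1),(1,3),(0,3),(0,2),(2,4),(0,4),(0,5),(5,6),(0,6)] [(0,1,3),(0,2,4),(0,5,6)] [(1,3),(2,4),(5,6),(0,4),(0,5),(0,6)]
    [(0,[1,2,3,4,5,6])] [(1,2),(2,3)] 7 rfl (by decide +kernel) hnd ?_ ?_ ?_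
  · exact fc ((clv a).2 (by simp)) (fc (hac) (fc ((clv c).2 (by simp)) (fc ((clv b).2 (by simp)) (fc (hbx) (fc ((clv x).2 (by simp)) (fc ((clv y).2 (by simp)) (fc (hyz) (fc ((clv z).2 (by simp)) (fn)))))))))
  · exact fc (fun z hz => by simpa using (clv z).1 hz) (fn)
  · exact fc (nab) (fc (nbc) (fn))

lemma T_6b [DecidableEq V] {G : SimpleGraph V} (hG : NoRed G) {v a b c x y z : V} (hnd : [v,a,b,c,x,y,z].Nodup)
    (clv : ∀ k, G.Adj v k ↔ k ∈ [a,b,c,x,y,z])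
    (hbx : G.Adj b x) (nab : ¬ G.Adj a b) (nbc : ¬ G.Adj b c) (nbz : ¬ G.Adj b z) (nxa : ¬ G.Adj x a) (nxc : ¬ G.Adj x c) (nxz : ¬ G.Adj x z) : False := by
  refine tmpl' hG v [v,a,b,c,x,y,z] [(0,2),(2,4),(0,4)] [(0,2,4)] [(2,4),(0,5)]
    [(0,[1,2,3,4,5,6])] [(1,2),(2,3),(2,6),(4,1),(4,3),(4,6)] 7 rfl (by decide +kernel) hnd ?_ ?_ ?_
  · exact fc ((clv b).2 (by simp)) (fc (hbx) (fc ((clv x).2 (by simp)) (fn)))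
  · exact fc (fun z hz => by simpa using (clv z).1 hz) (fn)
  · exact fc (nab) (fc (nbc) (fc (nbz) (fc (nxa) (fc (nxc) (fc (nxz) (fn))))))

lemma T_C3 [DecidableEq V] {G : SimpleGraph V} (hG : NoRed G) {u v a b c x y : V} (hnd : [u,v,a,b,c,x,y].Nodup)
    (clu : ∀ k, G.Adj u k ↔ k ∈ [v,a,b,c,x])
    (clv : ∀ k, G.Adj v k ↔ k ∈ [u,a,b,c,y])
    (hax : G.Adj a x) (hbc : G.Adj b c) (hby : G.Adj b y) (hac : G.Adj a c) : False := by
  refine tmpl' hG u [u,v,a,b,c,x,y] [(0,2),(2,5),(0,5),(0,3),(3,4),(0,4),(1,3),(3,6),(1,6),(1,2),(2,4),(1,4)] [(0,2,5),(0,3,4),(1,3,6),(1,2,4)] [(5,2),(3,4),(6,3),(2,4),(0,1),(0,5),(1,6),(2,3)]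
    [(0,[1,2,3,4,5]),(1,[0,2,3,4,6])] [] 7 rfl (by decide +kernel) hnd ?_ ?_ ?_
  · exact fc ((clu a).2 (by simp)) (fc (hax) (fc ((clu x).2 (by simp)) (fc ((clu b).2 (by simp)) (fc (hbc) (fc ((clu c).2 (by simp)) (fc ((clv b).2 (by simp)) (fc (hby) (fc ((clv y).2 (by simp)) (fc ((clv a).2 (by simp)) (fc (hac) (fc ((clv c).2 (by simp)) (fn))))))))))))
  · exact fc (fun z hz => by simpa using (clu z).1 hz) (fc (fun z hz => by simpa using (clv z).1 hz) (fn))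
  · exact fn

lemma T_C4 [DecidableEq V] {G : SimpleGraph V} (hG : NoRed G) {u v a b c d : V} (hnd : [u,v,a,b,c,d].Nodup)
    (clu : ∀ k, G.Adj u k ↔ k ∈ [v,a,b,c,d])
    (clv : ∀ k, G.Adj v k ↔ k ∈ [u,a,b,c,d])
    (hab : G.Adj a b) (hcd : G.Adj c d) (hbc : G.Adj b c) (had : G.Adj a d) : False := by
  refine tmpl' hG u [u,v,a,b,c,d] [(0,2),(2,3),(0,3),(0,4),(4,5),(0,5),(1,3),(3,4),(1,4),(1,2),(2,5),(1,5)] [(0,2,3),(0,4,5),(1,3,4),(1,2,5)] [(2,3),(3,4),(4,5),(5,2),(0,1),(2,4),(3,5)]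
    [(0,[1,2,3,4,5]),(1,[0,2,3,4,5])] [] 6 rfl (by decide +kernel) hnd ?_ ?_ ?_
  · exact fc ((clu a).2 (by simp)) (fc (hab) (fc ((clu b).2 (by simp)) (fc ((clu c).2 (by simp)) (fc (hcd) (fc ((clu d).2 (by simp)) (fc ((clv b).2 (by simp)) (fc (hbc) (fc ((clv c).2 (by simp)) (fc ((clv a).2 (by simp)) (fc (had) (fc ((clv d).2 (by simp)) (fn))))))))))))
  · exact fc (fun z hz => by simpa using (clu z).1 hz) (fc (fun z hz => by simpa using (clv z).1 hz) (fn))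
  · exact fn

lemma T_C4x [DecidableEq V] {G : SimpleGraph V} (hG : NoRed G) {u v a b c d x : V} (hnd : [u,v,a,b,c,d,x].Nodup)
    (clu : ∀ k, G.Adj u k ↔ k ∈ [v,a,b,c,d,x])
    (clv : ∀ k, G.Adj v k ↔ k ∈ [u,a,b,c,d])
    (hab : G.Adj a b) (hcd : G.Adj c d) (hbc : G.Adj b c) (had : G.Adj a d) : False := by
  refine tmpl' hG u [u,v,a,b,c,d,x] [(0,2),(2,3),(0,3),(0,4),(4,5),(0,5),(1,3),(3,4),(1,4),(1,2),(2,5),(1,5)] [(0,2,3),(0,4,5),(1,3,4),(1,2,5)] [(2,3),(3,4),(4,5),(5,2),(0,1),(2,4),(3,5),(0,6)]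
    [(0,[1,2,3,4,5,6]),(1,[0,2,3,4,5])] [] 7 rfl (by decide +kernel) hnd ?_ ?_ ?_
  · exact fc ((clu a).2 (by simp)) (fc (hab) (fc ((clu b).2 (by simp)) (fc ((clu c).2 (by simp)) (fc (hcd) (fc ((clu d).2 (by simp)) (fc ((clv b).2 (by simp)) (fc (hbc) (fc ((clv c).2 (by simp)) (fc ((clv a).2 (by simp)) (fc (had) (fc ((clv d).2 (by simp)) (fn))))))))))))
  · exact fc (fun z hz => by simpa using (clu z).1 hz) (fc (fun z hz => by simpa using (clv z).1 hz) (fn))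
  · exact fn

lemma T_C4xy [DecidableEq V] {G : SimpleGraph V} (hG : NoRed G) {u v a b c d x y : V} (hnd : [u,v,a,b,c,d,x,y].Nodup)
    (clu : ∀ k, G.Adj u k ↔ k ∈ [v,a,b,c,d,x])
    (clv : ∀ k, G.Adj v k ↔ k ∈ [u,a,b,c,d,y])
    (hax : G.Adj a x) (hcd : G.Adj c d) (hcy : G.Adj c y) (had : G.Adj a d) : False := by
  refine tmpl' hG u [u,v,a,b,c,d,x,y] [(0,2),(2,6),(0,6),(0,1),(1,3),(0,3),(0,4),(4,5),(0,5),(1,4),(4,7),(1,7),(1,2),(2,5),(1,5)] [(0,2,6),(0,1,3),(0,4,5),(1,4,7),(1,2,5)] [(4,5),(2,5),(6,2),(7,4),(0,1),(0,6),(1,7),(0,3),(1,3),(2,4)]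
    [(0,[1,2,3,4,5,6]),(1,[0,2,3,4,5,7])] [(0,7),(1,6)] 8 rfl (by decide +kernel) hnd ?_ ?_ ?_
  · exact fc ((clu a).2 (by simp)) (fc (hax) (fc ((clu x).2 (by simp)) (fc ((clu v).2 (by simp)) (fc ((clv b).2 (by simp)) (fc ((clu b).2 (by simp)) (fc ((clu c).2 (by simp)) (fc (hcd) (fc ((clu d).2 (by simp)) (fc ((clv c).2 (by simp)) (fc (hcy) (fc ((clv y).2 (by simp)) (fc ((clv a).2 (by simp)) (fc (had) (fc ((clv d).2 (by simp)) (fn)))))))))))))))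
  · exact fc (fun z hz => by simpa using (clu z).1 hz) (fc (fun z hz => by simpa using (clv z).1 hz) (fn))
  · exact fc (fun h => absurd ((clu y).1 h) (by clear * - hnd; simp at hnd ⊢; grind)) (fc (fun h => absurd ((clv x).1 h) (by clear * - hnd; simp at hnd ⊢; grind)) (fn))

lemma T_C5 [DecidableEq V] {G : SimpleGraph V} (hG : NoRed G) {u v a b c d e : V} (hnd : [u,v,a,b,c,d,e].Nodup)
    (clu : ∀ k, G.Adj u k ↔ k ∈ [v,a,b,c,d,e])
    (clv : ∀ k, G.Adj v k ↔ k ∈ [u,a,b,c,d,e])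
    (hab : G.Adj a b) (hcd : G.Adj c d) (hac : G.Adj a c) (hbd : G.Adj b d) : False := by
  refine tmpl' hG u [u,v,a,b,c,d,e] [(0,1),(1,6),(0,6),(0,2),(2,3),(0,3),(0,4),(4,5),(0,5),(1,2),(2,4),(1,4),(1,3),(3,5),(1,5)] [(0,1,6),(0,2,3),(0,4,5),(1,2,4),(1,3,5)] [(2,3),(4,5),(2,4),(3,5),(0,1),(2,5),(3,4),(0,6),(1,6)]
    [(0,[1,2,3,4,5,6]),(1,[0,2,3,4,5,6])] [] 7 rfl (by decide +kernel) hnd ?_ ?_ ?_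
  · exact fc ((clu v).2 (by simp)) (fc ((clv e).2 (by simp)) (fc ((clu e).2 (by simp)) (fc ((clu a).2 (by simp)) (fc (hab) (fc ((clu b).2 (by simp)) (fc ((clu c).2 (by simp)) (fc (hcd) (fc ((clu d).2 (by simp)) (fc ((clv a).2 (by simp)) (fc (hac) (fc ((clv c).2 (by simp)) (fc ((clv b).2 (by simp)) (fc (hbd) (fc ((clv d).2 (by simp)) (fn)))))))))))))))
  · exact fc (fun z hz => by simpa using (clu z).1 hz) (fc (fun z hz => by simpa using (clv z).1 hz) (fn))
  · exact fn

lemma T_A1 [DecidableEq V] {G : SimpleGraph V} (hG : NoRed G) {v w a b c d p q : V} (hnd : [v,w,a,b,c,d,p,q].Nodup)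
    (clv : ∀ k, G.Adj v k ↔ k ∈ [w,a,b,c,d])
    (clw : ∀ k, G.Adj w k ↔ k ∈ [v,a,b,c,d,p,q])
    (hab : G.Adj a b) (hcd : G.Adj c d) (hbc : G.Adj b c) (had : G.Adj a d) (nbd : ¬ G.Adj b d) : False := by
  refine tmpl' hG v [v,w,a,b,c,d,p,q] [(0,2),(2,3),(0,3),(0,4),(4,5),(0,5),(1,3),(3,4),(1,4),(1,2),(2,5),(1,5)] [(0,2,3),(0,4,5),(1,3,4),(1,2,5)] [(2,3),(3,4),(4,5),(5,2),(0,1),(1,6),(1,7),(2,4)]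
    [(0,[1,2,3,4,5]),(1,[0,2,3,4,5,6,7])] [(3,5),(0,6),(0,7)] 8 rfl (by decide +kernel) hnd ?_ ?_ ?_
  · exact fc ((clv a).2 (by simp)) (fc (hab) (fc ((clv b).2 (by simp)) (fc ((clv c).2 (by simp)) (fc (hcd) (fc ((clv d).2 (by simp)) (fc ((clw b).2 (by simp)) (fc (hbc) (fc ((clw c).2 (by simp)) (fc ((clw a).2 (by simp)) (fc (had) (fc ((clw d).2 (by simp)) (fn))))))))))))
  · exact fc (fun z hz => by simpa using (clv z).1 hz) (fc (fun z hz => by simpa using (clw z).1 hz) (fn))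
  · exact fc (nbd) (fc (fun h => absurd ((clv p).1 h) (by clear * - hnd; simp at hnd ⊢; grind)) (fc (fun h => absurd ((clv q).1 h) (by clear * - hnd; simp at hnd ⊢; grind)) (fn)))

lemma T_A2 [DecidableEq V] {G : SimpleGraph V} (hG : NoRed G) {v w a b c d p q : V} (hnd : [v,w,a,b,c,d,p,q].Nodup)
    (clv : ∀ k, G.Adj v k ↔ k ∈ [w,a,b,c,d])
    (clw : ∀ k, G.Adj w k ↔ k ∈ [v,a,b,c,d,p,q])
    (hab : G.Adj a b) (hcd : G.Adj c d) (hbc : G.Adj b c) (had : G.Adj a d) (hpq : G.Adj p q) : False := by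
  refine tmpl' hG v [v,w,a,b,c,d,p,q] [(0,2),(2,3),(0,3),(0,4),(4,5),(0,5),(1,3),(3,4),(1,4),(1,2),(2,5),(1,5),(1,6),(6,7),(1,7)] [(0,2,3),(0,4,5),(1,3,4),(1,2,5),(1,6,7)] [(2,3),(3,4),(4,5),(5,2),(2,4),(3,5),(0,1),(1,6),(1,7),(6,7)]
    [(0,[1,2,3,4,5]),(1,[0,2,3,4,5,6,7])] [(0,6),(0,7)] 8 rfl (by decide +kernel) hnd ?_ ?_ ?_
  · exact fc ((clv a).2 (by simp)) (fc (hab) (fc ((clv b).2 (by simp)) (fc ((clv c).2 (by simp)) (fc (hcd) (fc ((clv d).2 (by simp)) (fc ((clw b).2 (by simp)) (fc (hbc) (fc ((clw c).2 (by simp)) (fc ((clw a).2 (by simp)) (fc (had) (fc ((clw d).2 (by simp)) (fc ((clw p).2 (by simp)) (fc (hpq) (fc ((clw q).2 (by simp)) (fn)))))))))))))))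
  · exact fc (fun z hz => by simpa using (clv z).1 hz) (fc (fun z hz => by simpa using (clw z).1 hz) (fn))
  · exact fc (fun h => absurd ((clv p).1 h) (by clear * - hnd; simp at hnd ⊢; grind)) (fc (fun h => absurd ((clv q).1 h) (by clear * - hnd; simp at hnd ⊢; grind)) (fn))

lemma T_A3 [DecidableEq V] {G : SimpleGraph V} (hG : NoRed G) {v w a b c d p q : V} (hnd : [v,w,a,b,c,d,p,q].Nodup)
    (clv : ∀ k, G.Adj v k ↔ k ∈ [w,a,b,c,d])
    (clw : ∀ k, G.Adj w k ↔ k ∈ [v,a,b,c,d,p,q])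
    (hab : G.Adj a b) (hac : G.Adj a c) (hbc : G.Adj b c) (hcd : G.Adj c d) (hbd : G.Adj b d) (hcq : G.Adj c q) : False := by
  refine tmpl' hG v [v,w,a,b,c,d,p,q] [(1,2),(2,3),(1,3),(0,2),(2,4),(0,4),(3,4),(4,5),(3,5),(1,4),(4,7),(1,7),(0,1),(1,5),(0,5)] [(1,2,3),(0,2,4),(3,4,5),(1,4,7),(0,1,5)] [(2,3),(2,4),(2,5),(3,4),(3,5),(4,5),(4,7),(1,6),(1,7),(0,1)]
    [(0,[1,2,3,4,5]),(1,[0,2,3,4,5,6,7])] [(0,6),(0,7)] 8 rfl (by decide +kernel) hnd ?_ ?_ ?_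
  · exact fc ((clw a).2 (by simp)) (fc (hab) (fc ((clw b).2 (by simp)) (fc ((clv a).2 (by simp)) (fc (hac) (fc ((clv c).2 (by simp)) (fc (hbc) (fc (hcd) (fc (hbd) (fc ((clw c).2 (by simp)) (fc (hcq) (fc ((clw q).2 (by simp)) (fc ((clv w).2 (by simp)) (fc ((clw d).2 (by simp)) (fc ((clv d).2 (by simp)) (fn)))))))))))))))
  · exact fc (fun z hz => by simpa using (clv z).1 hz) (fc (fun z hz => by simpa using (clw z).1 hz) (fn))
  · exact fc (fun h => absurd ((clv p).1 h) (by clear * - hnd; simp at hnd ⊢; grind)) (fc (fun h => absurd ((clv q).1 h) (by clear * - hnd; simp at hnd ⊢; grind)) (fn))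

lemma T_B1 [DecidableEq V] {G : SimpleGraph V} (hG : NoRed G) {v w a b c x p q r : V} (hnd : [v,w,a,b,c,x,p,q,r].Nodup)
    (clv : ∀ k, G.Adj v k ↔ k ∈ [w,a,b,c,x])
    (clw : ∀ k, G.Adj w k ↔ k ∈ [v,a,b,c,p,q,r])
    (hap : G.Adj a p) (hbq : G.Adj b q) (npq : ¬ G.Adj p q) (npr : ¬ G.Adj p r) (nqr : ¬ G.Adj q r) : False := by
  refine tmpl' hG v [v,w,a,b,c,x,p,q,r] [(1,2),(2,6),(1,6),(1,3),(3,7),(1,7),(0,1),(1,4),(0,4)] [(1,2,6),(1,3,7),(0,1,4)] [(2,6),(2,1),(3,7),(3,1),(4,0),(4,1)]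
    [(0,[1,2,3,4,5]),(1,[0,2,3,4,6,7,8])] [(6,7),(6,8),(7,8),(0,6),(0,7),(0,8),(1,5)] 9 rfl (by decide +kernel) hnd ?_ ?_ ?_
  · exact fc ((clw a).2 (by simp)) (fc (hap) (fc ((clw p).2 (by simp)) (fc ((clw b).2 (by simp)) (fc (hbq) (fc ((clw q).2 (by simp)) (fc ((clv w).2 (by simp)) (fc ((clw c).2 (by simp)) (fc ((clv c).2 (by simp)) (fn)))))))))
  · exact fc (fun z hz => by simpa using (clv z).1 hz) (fc (fun z hz => by simpa using (clw z).1 hz) (fn))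
  · exact fc (npq) (fc (npr) (fc (nqr) (fc (fun h => absurd ((clv p).1 h) (by clear * - hnd; simp at hnd ⊢; grind)) (fc (fun h => absurd ((clv q).1 h) (by clear * - hnd; simp at hnd ⊢; grind)) (fc (fun h => absurd ((clv r).1 h) (by clear * - hnd; simp at hnd ⊢; grind)) (fc (fun h => absurd ((clw x).1 h) (by clear * - hnd; simp at hnd ⊢; grind)) (fn)))))))

lemma T_B2 [DecidableEq V] {G : SimpleGraph V} (hG : NoRed G) {v w a b c x p q r : V} (hnd : [v,w,a,b,c,x,p,q,r].Nodup)
    (clv : ∀ k, G.Adj v k ↔ k ∈ [w,a,b,c,x])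
    (clw : ∀ k, G.Adj w k ↔ k ∈ [v,a,b,c,p,q,r])
    (hac : G.Adj a c) (hpq : G.Adj p q) (npr : ¬ G.Adj p r) (nqr : ¬ G.Adj q r) : False := by
  refine tmpl' hG v [v,w,a,b,c,x,p,q,r] [(1,2),(2,4),(1,4),(0,1),(1,3),(0,3),(1,6),(6,7),(1,7)] [(1,2,4),(0,1,3),(1,6,7)] [(2,4),(2,1),(3,0),(3,1),(4,1),(6,7)]
    [(0,[1,2,3,4,5]),(1,[0,2,3,4,6,7,8])] [(6,8),(7,8),(0,6),(0,7),(0,8),(1,5)] 9 rfl (by decide +kernel) hnd ?_ ?_ ?_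
  · exact fc ((clw a).2 (by simp)) (fc (hac) (fc ((clw c).2 (by simp)) (fc ((clv w).2 (by simp)) (fc ((clw b).2 (by simp)) (fc ((clv b).2 (by simp)) (fc ((clw p).2 (by simp)) (fc (hpq) (fc ((clw q).2 (by simp)) (fn)))))))))
  · exact fc (fun z hz => by simpa using (clv z).1 hz) (fc (fun z hz => by simpa using (clw z).1 hz) (fn))
  · exact fc (npr) (fc (nqr) (fc (fun h => absurd ((clv p).1 h) (by clear * - hnd; simp at hnd ⊢; grind)) (fc (fun h => absurd ((clv q).1 h) (by clear * - hnd; simp at hnd ⊢; grind)) (fc (fun h => absurd ((clv r).1 h) (by clear * - hnd; simp at hnd ⊢; grind)) (fc (fun h => absurd ((clw x).1 h) (by clear * - hnd; simp at hnd ⊢; grind)) (fn))))))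

lemma T_Z1 [DecidableEq V] {G : SimpleGraph V} (hG : NoRed G) {v w a b c x p q r : V} (hnd : [v,w,a,b,c,x,p,q,r].Nodup)
    (clv : ∀ k, G.Adj v k ↔ k ∈ [w,a,b,c,x])
    (clw : ∀ k, G.Adj w k ↔ k ∈ [v,a,b,c,p,q,r])
    (har : G.Adj a r) (hbx : G.Adj b x) (hpq : G.Adj p q) (nqr : ¬ G.Adj q r) (naq : ¬ G.Adj a q) : False := by
  refine tmpl' hG v [v,w,a,b,c,x,p,q,r] [(1,2),(2,8),(1,8),(0,3),(3,5),(0,5),(0,1),(1,4),(0,4),(1,6),(6,7),(1,7)] [(1,2,8),(0,3,5),(0,1,4),(1,6,7)] [(2,8),(2,0),(3,1),(3,5),(4,0),(4,1),(6,7),(6,1)]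
    [(0,[1,2,3,4,5]),(1,[0,2,3,4,6,7,8])] [(7,8),(2,7),(0,6),(0,7),(0,8),(1,5)] 9 rfl (by decide +kernel) hnd ?_ ?_ ?_
  · exact fc ((clw a).2 (by simp)) (fc (har) (fc ((clw r).2 (by simp)) (fc ((clv b).2 (by simp)) (fc (hbx) (fc ((clv x).2 (by simp)) (fc ((clv w).2 (by simp)) (fc ((clw c).2 (by simp)) (fc ((clv c).2 (by simp)) (fc ((clw p).2 (by simp)) (fc (hpq) (fc ((clw q).2 (by simp)) (fn))))))))))))
  · exact fc (fun z hz => by simpa using (clv z).1 hz) (fc (fun z hz => by simpa using (clw z).1 hz) (fn))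
  · exact fc (nqr) (fc (naq) (fc (fun h => absurd ((clv p).1 h) (by clear * - hnd; simp at hnd ⊢; grind)) (fc (fun h => absurd ((clv q).1 h) (by clear * - hnd; simp at hnd ⊢; grind)) (fc (fun h => absurd ((clv r).1 h) (by clear * - hnd; simp at hnd ⊢; grind)) (fc (fun h => absurd ((clw x).1 h) (by clear * - hnd; simp at hnd ⊢; grind)) (fn))))))

lemma T_Z2 [DecidableEq V] {G : SimpleGraph V} (hG : NoRed G) {v w a b c x p q r : V} (hnd : [v,w,a,b,c,x,p,q,r].Nodup)
    (clv : ∀ k, G.Adj v k ↔ k ∈ [w,a,b,c,x])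
    (clw : ∀ k, G.Adj w k ↔ k ∈ [v,a,b,c,p,q,r])
    (hab : G.Adj a b) (hac : G.Adj a c) (hcr : G.Adj c r) (har : G.Adj a r) (haq : G.Adj a q) (hbc : G.Adj b c) (hcq : G.Adj c q) (hbq : G.Adj b q) (hbr : G.Adj b r) (nqr : ¬ G.Adj q r) : False := by
  refine tmpl' hG v [v,w,a,b,c,x,p,q,r] [(0,2),(2,3),(0,3),(2,4),(4,8),(2,8),(1,2),(2,7),(1,7),(3,4),(4,7),(3,7),(1,3),(3,8),(1,8),(0,1),(1,4),(0,4)] [(0,2,3),(2,4,8),(1,2,7),(3,4,7),(1,3,8),(0,1,4)] [(2,3),(2,4),(2,7),(2,8),(3,4),(3,7),(3,8),(4,7),(4,8),(6,1),(0,1),(0,5)]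
    [(0,[1,2,3,4,5]),(1,[0,2,3,4,6,7,8])] [(7,8),(0,6),(0,7),(0,8),(1,5)] 9 rfl (by decide +kernel) hnd ?_ ?_ ?_
  · exact fc ((clv a).2 (by simp)) (fc (hab) (fc ((clv b).2 (by simp)) (fc (hac) (fc (hcr) (fc (har) (fc ((clw a).2 (by simp)) (fc (haq) (fc ((clw q).2 (by simp)) (fc (hbc) (fc (hcq) (fc (hbq) (fc ((clw b).2 (by simp)) (fc (hbr) (fc ((clw r).2 (by simp)) (fc ((clv w).2 (by simp)) (fc ((clw c).2 (by simp)) (fc ((clv c).2 (by simp)) (fn))))))))))))))))))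
  · exact fc (fun z hz => by simpa using (clv z).1 hz) (fc (fun z hz => by simpa using (clw z).1 hz) (fn))
  · exact fc (nqr) (fc (fun h => absurd ((clv p).1 h) (by clear * - hnd; simp at hnd ⊢; grind)) (fc (fun h => absurd ((clv q).1 h) (by clear * - hnd; simp at hnd ⊢; grind)) (fc (fun h => absurd ((clv r).1 h) (by clear * - hnd; simp at hnd ⊢; grind)) (fc (fun h => absurd ((clw x).1 h) (by clear * - hnd; simp at hnd ⊢; grind)) (fn)))))

lemma T_Z3 [DecidableEq V] {G : SimpleGraph V} (hG : NoRed G) {v w a b c x p q r : V} (hnd : [v,w,a,b,c,x,p,q,r].Nodup)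
    (clv : ∀ k, G.Adj v k ↔ k ∈ [w,a,b,c,x])
    (clw : ∀ k, G.Adj w k ↔ k ∈ [v,a,b,c,p,q,r])
    (haq : G.Adj a q) (hbr : G.Adj b r) (ncq : ¬ G.Adj c q) (ncr : ¬ G.Adj c r) (nqr : ¬ G.Adj q r) : False := by
  refine tmpl' hG v [v,w,a,b,c,x,p,q,r] [(0,1),(1,4),(0,4),(1,2),(2,7),(1,7),(1,3),(3,8),(1,8)] [(0,1,4),(1,2,7),(1,3,8)] [(0,4),(2,7),(3,8),(1,2),(1,3),(1,6)]
    [(0,[1,2,3,4,5]),(1,[0,2,3,4,6,7,8])] [(4,7),(4,8),(7,8),(0,6),(0,7),(0,8),(1,5)] 9 rfl (by decide +kernel) hnd ?_ ?_ ?_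
  · exact fc ((clv w).2 (by simp)) (fc ((clw c).2 (by simp)) (fc ((clv c).2 (by simp)) (fc ((clw a).2 (by simp)) (fc (haq) (fc ((clw q).2 (by simp)) (fc ((clw b).2 (by simp)) (fc (hbr) (fc ((clw r).2 (by simp)) (fn)))))))))
  · exact fc (fun z hz => by simpa using (clv z).1 hz) (fc (fun z hz => by simpa using (clw z).1 hz) (fn))
  · exact fc (ncq) (fc (ncr) (fc (nqr) (fc (fun h => absurd ((clv p).1 h) (by clear * - hnd; simp at hnd ⊢; grind)) (fc (fun h => absurd ((clv q).1 h) (by clear * - hnd; simp at hnd ⊢; grind)) (fc (fun h => absurd ((clv r).1 h) (by clear * - hnd; simp at hnd ⊢; grind)) (fc (fun h => absurd ((clw x).1 h) (by clear * - hnd; simp at hnd ⊢; grind)) (fn)))))))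

lemma T_Mix [DecidableEq V] {G : SimpleGraph V} (hG : NoRed G) {v w a b c x p q r : V} (hnd : [v,w,a,b,c,x,p,q,r].Nodup)
    (clv : ∀ k, G.Adj v k ↔ k ∈ [w,a,b,c,x])
    (clw : ∀ k, G.Adj w k ↔ k ∈ [v,a,b,c,p,q,r])
    (hab : G.Adj a b) (hap : G.Adj a p) (hbc : G.Adj b c) (hcx : G.Adj c x) (hqr : G.Adj q r) (nbp : ¬ G.Adj b p) : False := by
  refine tmpl' hG v [v,w,a,b,c,x,p,q,r] [(0,2),(2,3),(0,3),(1,2),(2,6),(1,6),(1,3),(3,4),(1,4),(0,4),(4,5),(0,5),(1,7),(7,8),(1,8)] [(0,2,3),(1,2,6),(1,3,4),(0,4,5),(1,7,8)] [(2,3),(2,6),(2,0),(3,4),(3,0),(4,1),(4,5),(7,8),(7,1),(8,1)]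
    [(0,[1,2,3,4,5]),(1,[0,2,3,4,6,7,8])] [(3,6),(0,6),(0,7),(0,8),(1,5)] 9 rfl (by decide +kernel) hnd ?_ ?_ ?_
  · exact fc ((clv a).2 (by simp)) (fc (hab) (fc ((clv b).2 (by simp)) (fc ((clw a).2 (by simp)) (fc (hap) (fc ((clw p).2 (by simp)) (fc ((clw b).2 (by simp)) (fc (hbc) (fc ((clw c).2 (by simp)) (fc ((clv c).2 (by simp)) (fc (hcx) (fc ((clv x).2 (by simp)) (fc ((clw q).2 (by simp)) (fc (hqr) (fc ((clw r).2 (by simp)) (fn)))))))))))))))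
  · exact fc (fun z hz => by simpa using (clv z).1 hz) (fc (fun z hz => by simpa using (clw z).1 hz) (fn))
  · exact fc (nbp) (fc (fun h => absurd ((clv p).1 h) (by clear * - hnd; simp at hnd ⊢; grind)) (fc (fun h => absurd ((clv q).1 h) (by clear * - hnd; simp at hnd ⊢; grind)) (fc (fun h => absurd ((clv r).1 h) (by clear * - hnd; simp at hnd ⊢; grind)) (fc (fun h => absurd ((clw x).1 h) (by clear * - hnd; simp at hnd ⊢; grind)) (fn)))))

lemma T_Z4 [DecidableEq V] {G : SimpleGraph V} (hG : NoRed G) {v w a b c x p q r : V} (hnd : [v,w,a,b,c,x,p,q,r].Nodup)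
    (clv : ∀ k, G.Adj v k ↔ k ∈ [w,a,b,c,x])
    (clw : ∀ k, G.Adj w k ↔ k ∈ [v,a,b,c,p,q,r])
    (hab : G.Adj a b) (hbx : G.Adj b x) (hax : G.Adj a x) (hac : G.Adj a c) (hcx : G.Adj c x) (hqr : G.Adj q r) (nap : ¬ G.Adj a p) (nbp : ¬ G.Adj b p) (ncp : ¬ G.Adj c p) : False := by
  refine tmpl' hG v [v,w,a,b,c,x,p,q,r] [(2,3),(3,5),(2,5),(1,2),(2,4),(1,4),(0,1),(1,3),(0,3),(0,4),(4,5),(0,5),(1,7),(7,8),(1,8)] [(2,3,5),(1,2,4),(0,1,3),(0,4,5),(1,7,8)] [(2,3),(2,4),(2,5),(3,4),(3,5),(4,5),(7,8),(7,1),(8,1),(0,1)]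
    [(0,[1,2,3,4,5]),(1,[0,2,3,4,6,7,8])] [(2,6),(3,6),(4,6),(0,6),(0,7),(0,8),(1,5)] 9 rfl (by decide +kernel) hnd ?_ ?_ ?_
  · exact fc (hab) (fc (hbx) (fc (hax) (fc ((clw a).2 (by simp)) (fc (hac) (fc ((clw c).2 (by simp)) (fc ((clv w).2 (by simp)) (fc ((clw b).2 (by simp)) (fc ((clv b).2 (by simp)) (fc ((clv c).2 (by simp)) (fc (hcx) (fc ((clv x).2 (by simp)) (fc ((clw q).2 (by simp)) (fc (hqr) (fc ((clw r).2 (by simp)) (fn)))))))))))))))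
  · exact fc (fun z hz => by simpa using (clv z).1 hz) (fc (fun z hz => by simpa using (clw z).1 hz) (fn))
  · exact fc (nap) (fc (nbp) (fc (ncp) (fc (fun h => absurd ((clv p).1 h) (by clear * - hnd; simp at hnd ⊢; grind)) (fc (fun h => absurd ((clv q).1 h) (by clear * - hnd; simp at hnd ⊢; grind)) (fc (fun h => absurd ((clv r).1 h) (by clear * - hnd; simp at hnd ⊢; grind)) (fc (fun h => absurd ((clw x).1 h) (by clear * - hnd; simp at hnd ⊢; grind)) (fn)))))))

lemma T_C7 [DecidableEq V] {G : SimpleGraph V} (hG : NoRed G) {v w a b c d e p : V} (hnd : [v,w,a,b,c,d,e,p].Nodup)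
    (clv : ∀ k, G.Adj v k ↔ k ∈ [w,a,b,c,d,e])
    (clw : ∀ k, G.Adj w k ↔ k ∈ [v,a,b,c,d,e,p])
    (hab : G.Adj a b) (hcd : G.Adj c d) (hac : G.Adj a c) (hbd : G.Adj b d) : False := by
  refine tmpl' hG v [v,w,a,b,c,d,e,p] [(0,1),(1,6),(0,6),(0,2),(2,3),(0,3),(0,4),(4,5),(0,5),(1,2),(2,4),(1,4),(1,3),(3,5),(1,5)] [(0,1,6),(0,2,3),(0,4,5),(1,2,4),(1,3,5)] [(2,3),(4,5),(2,4),(3,5),(0,1),(2,5),(3,4),(0,6),(1,6),(1,7)]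
    [(0,[1,2,3,4,5,6]),(1,[0,2,3,4,5,6,7])] [(0,7)] 8 rfl (by decide +kernel) hnd ?_ ?_ ?_
  · exact fc ((clv w).2 (by simp)) (fc ((clw e).2 (by simp)) (fc ((clv e).2 (by simp)) (fc ((clv a).2 (by simp)) (fc (hab) (fc ((clv b).2 (by simp)) (fc ((clv c).2 (by simp)) (fc (hcd) (fc ((clv d).2 (by simp)) (fc ((clw a).2 (by simp)) (fc (hac) (fc ((clw c).2 (by simp)) (fc ((clw b).2 (by simp)) (fc (hbd) (fc ((clw d).2 (by simp)) (fn)))))))))))))))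
  · exact fc (fun z hz => by simpa using (clv z).1 hz) (fc (fun z hz => by simpa using (clw z).1 hz) (fn))
  · exact fc (fun h => absurd ((clv p).1 h) (by clear * - hnd; simp at hnd ⊢; grind)) (fn)

lemma T_D1 [DecidableEq V] {G : SimpleGraph V} (hG : NoRed G) {v w a b c d x p q : V} (hnd : [v,w,a,b,c,d,x,p,q].Nodup)
    (clv : ∀ k, G.Adj v k ↔ k ∈ [w,a,b,c,d,x])
    (clw : ∀ k, G.Adj w k ↔ k ∈ [v,a,b,c,d,p,q])
    (hab : G.Adj a b) (had : G.Adj a d) (hbc : G.Adj b c) (hcd : G.Adj c d) (nac : ¬ G.Adj a c) (nbd : ¬ G.Adj b d) : False := by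
  refine tmpl' hG v [v,w,a,b,c,d,x,p,q] [(0,2),(2,3),(0,3),(1,2),(2,5),(1,5),(1,3),(3,4),(1,4),(0,4),(4,5),(0,5)] [(0,2,3),(1,2,5),(1,3,4),(0,4,5)] [(2,3),(2,5),(3,4),(4,5),(7,1),(8,1),(0,1),(0,6)]
    [(0,[1,2,3,4,5,6]),(1,[0,2,3,4,5,7,8])] [(2,4),(3,5),(0,7),(0,8),(1,6)] 9 rfl (by decide +kernel) hnd ?_ ?_ ?_
  · exact fc ((clv a).2 (by simp)) (fc (hab) (fc ((clv b).2 (by simp)) (fc ((clw a).2 (by simp)) (fc (had) (fc ((clw d).2 (by simp)) (fc ((clw b).2 (by simp)) (fc (hbc) (fc ((clw c).2 (by simp)) (fc ((clv c).2 (by simp)) (fc (hcd) (fc ((clv d).2 (by simp)) (fn))))))))))))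
  · exact fc (fun z hz => by simpa using (clv z).1 hz) (fc (fun z hz => by simpa using (clw z).1 hz) (fn))
  · exact fc (nac) (fc (nbd) (fc (fun h => absurd ((clv p).1 h) (by clear * - hnd; simp at hnd ⊢; grind)) (fc (fun h => absurd ((clv q).1 h) (by clear * - hnd; simp at hnd ⊢; grind)) (fc (fun h => absurd ((clw x).1 h) (by clear * - hnd; simp at hnd ⊢; grind)) (fn)))))

lemma T_D2 [DecidableEq V] {G : SimpleGraph V} (hG : NoRed G) {v w a b c d x p q : V} (hnd : [v,w,a,b,c,d,x,p,q].Nodup)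
    (clv : ∀ k, G.Adj v k ↔ k ∈ [w,a,b,c,d,x])
    (clw : ∀ k, G.Adj w k ↔ k ∈ [v,a,b,c,d,p,q])
    (hab : G.Adj a b) (hac : G.Adj a c) (hcd : G.Adj c d) (had : G.Adj a d) (hbc : G.Adj b c) (hcx : G.Adj c x) (hpq : G.Adj p q) : False := by
  refine tmpl' hG v [v,w,a,b,c,d,x,p,q] [(0,2),(2,3),(0,3),(2,4),(4,5),(2,5),(1,3),(3,4),(1,4),(0,4),(4,6),(0,6),(0,1),(1,5),(0,5),(1,7),(7,8),(1,8)] [(0,2,3),(2,4,5),(1,3,4),(0,4,6),(0,1,5),(1,7,8)] [(2,3),(2,4),(2,5),(3,4),(3,5),(4,5),(4,6),(7,8),(7,1),(8,1),(0,1),(0,6)]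
    [(0,[1,2,3,4,5,6]),(1,[0,2,3,4,5,7,8])] [(0,7),(0,8),(1,6)] 9 rfl (by decide +kernel) hnd ?_ ?_ ?_
  · exact fc ((clv a).2 (by simp)) (fc (hab) (fc ((clv b).2 (by simp)) (fc (hac) (fc (hcd) (fc (had) (fc ((clw b).2 (by simp)) (fc (hbc) (fc ((clw c).2 (by simp)) (fc ((clv c).2 (by simp)) (fc (hcx) (fc ((clv x).2 (by simp)) (fc ((clv w).2 (by simp)) (fc ((clw d).2 (by simp)) (fc ((clv d).2 (by simp)) (fc ((clw p).2 (by simp)) (fc (hpq) (fc ((clw q).2 (by simp)) (fn))))))))))))))))))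
  · exact fc (fun z hz => by simpa using (clv z).1 hz) (fc (fun z hz => by simpa using (clw z).1 hz) (fn))
  · exact fc (fun h => absurd ((clv p).1 h) (by clear * - hnd; simp at hnd ⊢; grind)) (fc (fun h => absurd ((clv q).1 h) (by clear * - hnd; simp at hnd ⊢; grind)) (fc (fun h => absurd ((clw x).1 h) (by clear * - hnd; simp at hnd ⊢; grind)) (fn)))

lemma T_D3 [DecidableEq V] {G : SimpleGraph V} (hG : NoRed G) {v w a b c d x p q : V} (hnd : [v,w,a,b,c,d,x,p,q].Nodup)
    (clv : ∀ k, G.Adj v k ↔ k ∈ [w,a,b,c,d,x])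
    (clw : ∀ k, G.Adj w k ↔ k ∈ [v,a,b,c,d,p,q])
    (hab : G.Adj a b) (hac : G.Adj a c) (hcd : G.Adj c d) (had : G.Adj a d) (hap : G.Adj a p) (hbc : G.Adj b c) (hcx : G.Adj c x) : False := by
  refine tmpl' hG v [v,w,a,b,c,d,x,p,q] [(0,2),(2,3),(0,3),(2,4),(4,5),(2,5),(1,2),(2,7),(1,7),(1,3),(3,4),(1,4),(0,4),(4,6),(0,6),(0,1),(1,5),(0,5)] [(0,2,3),(2,4,5),(1,2,7),(1,3,4),(0,4,6),(0,1,5)] [(2,3),(2,4),(2,5),(2,7),(3,4),(3,5),(4,5),(4,6),(7,1),(8,1),(0,1),(0,6)]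
    [(0,[1,2,3,4,5,6]),(1,[0,2,3,4,5,7,8])] [(0,7),(0,8),(1,6)] 9 rfl (by decide +kernel) hnd ?_ ?_ ?_
  · exact fc ((clv a).2 (by simp)) (fc (hab) (fc ((clv b).2 (by simp)) (fc (hac) (fc (hcd) (fc (had) (fc ((clw a).2 (by simp)) (fc (hap) (fc ((clw p).2 (by simp)) (fc ((clw b).2 (by simp)) (fc (hbc) (fc ((clw c).2 (by simp)) (fc ((clv c).2 (by simp)) (fc (hcx) (fc ((clv x).2 (by simp)) (fc ((clv w).2 (by simp)) (fc ((clw d).2 (by simp)) (fc ((clv d).2 (by simp)) (fn))))))))))))))))))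
  · exact fc (fun z hz => by simpa using (clv z).1 hz) (fc (fun z hz => by simpa using (clw z).1 hz) (fn))
  · exact fc (fun h => absurd ((clv p).1 h) (by clear * - hnd; simp at hnd ⊢; grind)) (fc (fun h => absurd ((clv q).1 h) (by clear * - hnd; simp at hnd ⊢; grind)) (fc (fun h => absurd ((clw x).1 h) (by clear * - hnd; simp at hnd ⊢; grind)) (fn)))

lemma T_Q4 [DecidableEq V] {G : SimpleGraph V} (hG : NoRed G) {u v a b c d p q : V} (hnd : [u,v,a,b,c,d,p,q].Nodup)
    (clv : ∀ k, G.Adj v k ↔ k ∈ [a,b,c,d,p])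
    (clu : ∀ k, G.Adj u k ↔ k ∈ [a,b,c,d,q])
    (hab : G.Adj a b) (hcd : G.Adj c d) (hbc : G.Adj b c) (had : G.Adj a d) : False := by
  refine tmpl' hG u [u,v,a,b,c,d,p,q] [(1,2),(2,3),(1,3),(1,4),(4,5),(1,5),(0,3),(3,4),(0,4),(0,2),(2,5),(0,5)] [(1,2,3),(1,4,5),(0,3,4),(0,2,5)] [(2,3),(3,4),(4,5),(5,2),(2,4),(3,5),(1,6),(0,7)]
    [(1,[2,3,4,5,6]),(0,[2,3,4,5,7])] [] 8 rfl (by decide +kernel) hnd ?_ ?_ ?_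
  · exact fc ((clv a).2 (by simp)) (fc (hab) (fc ((clv b).2 (by simp)) (fc ((clv c).2 (by simp)) (fc (hcd) (fc ((clv d).2 (by simp)) (fc ((clu b).2 (by simp)) (fc (hbc) (fc ((clu c).2 (by simp)) (fc ((clu a).2 (by simp)) (fc (had) (fc ((clu d).2 (by simp)) (fn))))))))))))
  · exact fc (fun z hz => by simpa using (clv z).1 hz) (fc (fun z hz => by simpa using (clu z).1 hz) (fn))
  · exact fn

lemma T_Q5 [DecidableEq V] {G : SimpleGraph V} (hG : NoRed G) {u v a b c d p : V} (hnd : [u,v,a,b,c,d,p].Nodup)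
    (clv : ∀ k, G.Adj v k ↔ k ∈ [a,b,c,d,p])
    (clu : ∀ k, G.Adj u k ↔ k ∈ [a,b,c,d,p])
    (hab : G.Adj a b) (hcd : G.Adj c d) (hbc : G.Adj b c) (had : G.Adj a d) : False := by
  refine tmpl' hG u [u,v,a,b,c,d,p] [(1,2),(2,3),(1,3),(1,4),(4,5),(1,5),(0,3),(3,4),(0,4),(0,2),(2,5),(0,5)] [(1,2,3),(1,4,5),(0,3,4),(0,2,5)] [(2,3),(3,4),(4,5),(5,2),(2,4),(3,5),(1,6),(0,6)]
    [(1,[2,3,4,5,6]),(0,[2,3,4,5,6])] [] 7 rfl (by decide +kernel) hnd ?_ ?_ ?_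
  · exact fc ((clv a).2 (by simp)) (fc (hab) (fc ((clv b).2 (by simp)) (fc ((clv c).2 (by simp)) (fc (hcd) (fc ((clv d).2 (by simp)) (fc ((clu b).2 (by simp)) (fc (hbc) (fc ((clu c).2 (by simp)) (fc ((clu a).2 (by simp)) (fc (had) (fc ((clu d).2 (by simp)) (fn))))))))))))
  · exact fc (fun z hz => by simpa using (clv z).1 hz) (fc (fun z hz => by simpa using (clu z).1 hz) (fn))
  · exact fn

lemma T_P3 [DecidableEq V] {G : SimpleGraph V} (hG : NoRed G) {u v w b c x y s t : V} (hnd : [u,v,w,b,c,x,y,s,t].Nodup)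
    (clv : ∀ k, G.Adj v k ↔ k ∈ [w,b,c,x,y])
    (clu : ∀ k, G.Adj u k ↔ k ∈ [w,b,c,s,t])
    (hbc : G.Adj b c) (hcx : G.Adj c x) (hbx : G.Adj b x) (hwb : G.Adj w b) (hcs : G.Adj c s) (hwc : G.Adj w c) (hxy : G.Adj x y) (nwx : ¬ G.Adj w x) : False := by
  refine tmpl' hG u [u,v,w,b,c,x,y,s,t] [(3,4),(4,5),(3,5),(0,2),(2,3),(0,3),(0,4),(4,7),(0,7),(1,2),(2,4),(1,4),(1,5),(5,6),(1,6)] [(3,4,5),(0,2,3),(0,4,7),(1,2,4),(1,5,6)] [(3,4),(3,2),(3,5),(4,7),(4,2),(4,5),(7,0),(8,0),(1,6),(5,6)]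
    [(1,[2,3,4,5,6]),(0,[2,3,4,7,8])] [(2,5)] 9 rfl (by decide +kernel) hnd ?_ ?_ ?_
  · exact fc (hbc) (fc (hcx) (fc (hbx) (fc ((clu w).2 (by simp)) (fc (hwb) (fc ((clu b).2 (by simp)) (fc ((clu c).2 (by simp)) (fc (hcs) (fc ((clu s).2 (by simp)) (fc ((clv w).2 (by simp)) (fc (hwc) (fc ((clv c).2 (by simp)) (fc ((clv x).2 (by simp)) (fc (hxy) (fc ((clv y).2 (by simp)) (fn)))))))))))))))
  · exact fc (fun z hz => by simpa using (clv z).1 hz) (fc (fun z hz => by simpa using (clu z).1 hz) (fn))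
  · exact fc (nwx) (fn)


lemma pm [DecidableEq V] {l l' : List V} (h : ∀ k, l.count k = l'.count k := by
    intro k; simp only [List.count_cons, List.cons_append, List.nil_append]; ac_rfl) : l.Perm l' := List.perm_iff_count.2 h

def NB (G : SimpleGraph V) (v : V) (l : List V) : Prop := l.Nodup ∧ ∀ k, G.Adj v k ↔ k ∈ l

lemma NB.perm {G : SimpleGraph V} {v : V} {l l' : List V} (h : NB G v l) (hp : l.Perm l') : NB G v l' :=
  ⟨hp.nodup_iff.1 h.1, fun k => (h.2 k).trans hp.mem_iff⟩

lemma NB.nd {G : SimpleGraph V} {v : V} {l : List V} (h : NB G v l) : (v :: l).Nodup :=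
  List.nodup_cons.2 ⟨fun hv => G.irrefl ((h.2 v).2 hv), h.1⟩

lemma NB.ext {G : SimpleGraph V} {v : V} {l : List V} (h : NB G v l) (s : List V) (hs : s.Nodup)
    (hsl : ∀ x ∈ s, G.Adj v x) : ∃ l', NB G v (s ++ l') ∧ s.length + l'.length = l.length := by
  have h1 : s.Subperm l := List.subperm_of_subset hs (fun x hx => (h.2 x).1 (hsl x hx))
  obtain ⟨s', hp, hs'⟩ := h1
  obtain ⟨l', hl'⟩ := hs'.exists_perm_append
  replace hl' := hl'.trans (hp.append_right l')
  exact ⟨l', h.perm hl', by rw [hl'.length_eq, List.length_append]⟩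

lemma NB.len {G : SimpleGraph V} {v : V} {l l' : List V} (h : NB G v l) (h' : NB G v l') :
    l.length = l'.length := by
  have : l.Perm l' := (List.perm_ext_iff_of_nodup h.1 h'.1).2 (fun a => by rw [← h.2, ← h'.2])
  exact this.length_eq

lemma exI [DecidableEq V] {G : SimpleGraph V} (hG : NoRed G) {w : V} {l : List V} (hw : NB G w l)
    (I J : List V) (hnd : I.Nodup) (hne : I ≠ []) (hIw : ∀ i ∈ I, G.Adj w i)
    (hind : I.Pairwise fun a b => ¬ G.Adj a b) (hJ : J.length ≤ I.length) :
    ∃ i ∈ I, ∃ z ∈ l, G.Adj i z ∧ z ∉ J := by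
  by_contra! hc
  have := exp_l hG w I J hnd hne hIw ?_ ?_
  · omega
  · exact fun i hi j hj => by
      by_cases hij : i = j
      · subst hij; exact G.irrefl
      · exact hind.forall_of_forall_of_flip (R := fun a b => ¬ G.Adj a b) (fun x _ => G.irrefl) (hind.imp (fun h h' => h h'.symm)) hi hj
  · intro i hi z hz hiz
    exact hc i hi z ((hw.2 z).1 hz) hiz

lemma ex1 [DecidableEq V] {G : SimpleGraph V} (hG : NoRed G) {w : V} {l : List V} (hw : NB G w l)
    (a c : V) (ha : G.Adj w a) : ∃ z ∈ l, G.Adj a z ∧ z ≠ c := by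
  have := exI hG hw [a] [c] (by simp) (by simp) (by simpa using ha) (by simp) (by simp)
  simpa using this

lemma ex3 [DecidableEq V] {G : SimpleGraph V} (hG : NoRed G) {w : V} {l : List V} (hw : NB G w l)
    (hl : l.length ≤ 6) (a b c : V) (hnd : [a,b,c].Nodup) (ha : G.Adj w a) (hb : G.Adj w b) (hc : G.Adj w c)
    (hab : ¬ G.Adj a b) (hac : ¬ G.Adj a c) (hbc : ¬ G.Adj b c) : False := by
  obtain ⟨l', h, hlen⟩ := hw.ext [a,b,c] hnd (by simp [ha, hb, hc])
  have := exI hG h [a,b,c] l' hnd (by simp) (by simp [ha, hb, hc]) (by simp [hab, hac, hbc]) (by simp at hlen ⊢; omega)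
  obtain ⟨i, hi, z, hz, hiz, hz'⟩ := this
  have := hiz.symm
  simp at hi hz
  have ia := G.irrefl (v := a)
  have ib := G.irrefl (v := b)
  have ic := G.irrefl (v := c)
  have s1 : ¬ G.Adj b a := fun h => hab h.symm
  have s2 : ¬ G.Adj c a := fun h => hac h.symm
  have s3 : ¬ G.Adj c b := fun h => hbc h.symm
  rcases hi with rfl | rfl | rfl <;> rcases hz with rfl | rfl | rfl | hz <;> tauto

lemma deg_ge [DecidableEq V] {G : SimpleGraph V} (hG : NoRed G) {v : V} {l : List V} (hv : NB G v l)
    (hl : l ≠ []) : 5 ≤ l.length := by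
  by_contra! hlt
  have ir := fun x => G.irrefl (v := x)
  have sy := fun x y => G.adj_comm x y
  match l, hl, hlt with
  | [a], _, _ =>
    obtain ⟨z, hz, h1, h2⟩ := ex1 hG hv a a ((hv.2 a).2 (by simp))
    simp at hz; grind
  | [a, b], _, _ =>
    obtain ⟨z, hz, h1, h2⟩ := ex1 hG hv a b ((hv.2 a).2 (by simp))
    simp at hz; grind
  | [a, b, c], _, _ =>
    obtain ⟨z, hz, h1, h2⟩ := ex1 hG hv a b ((hv.2 a).2 (by simp))
    simp at hz
    have : z = c := by grind
    subst this
    have h := hv.perm (l' := [a, z, b]) pm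
    exact T_3 hG h.nd h.2 h1
  | [a, b, c, d], _, _ =>
    have e := fun x y (h : x ∈ [a,b,c,d]) => ex1 hG hv x y ((hv.2 x).2 h)
    have k1 : ¬ (G.Adj a b ∧ G.Adj c d) := fun h => T_4 hG hv.nd hv.2 h.1 h.2
    have k2 : ¬ (G.Adj a c ∧ G.Adj b d) := fun h => by
      have hh := hv.perm (l' := [a, c, b, d]) pm
      exact T_4 hG hh.nd hh.2 h.1 h.2
    have k3 : ¬ (G.Adj a d ∧ G.Adj b c) := fun h => by
      have hh := hv.perm (l' := [a, d, b, c]) pm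
      exact T_4 hG hh.nd hh.2 h.1 h.2
    have f : ∀ x y, x ∈ [a,b,c,d] → ∃ z ∈ [a,b,c,d], G.Adj x z ∧ z ≠ y := e
    have a1 := f a b (by simp)
    have a2 := f a c (by simp)
    have a3 := f a d (by simp)
    have b1 := f b a (by simp)
    have b2 := f b c (by simp)
    have b3 := f b d (by simp)
    have c1 := f c a (by simp)
    have c2 := f c b (by simp)
    have c3 := f c d (by simp)
    have d1 := f d a (by simp)
    have d2 := f d b (by simp)
    have d3 := f d c (by simp)
    have hnd := hv.nd
    have q1 := sy b a
    have q2 := sy c a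
    have q3 := sy d a
    have q4 := sy c b
    have q5 := sy d b
    have q6 := sy d c
    clear f e sy hv
    simp at *
    grind

lemma cm6 [DecidableEq V] {G : SimpleGraph V} (hG : NoRed G) {v a b c x y z : V}
    (hv : NB G v [a,b,c,x,y,z]) (hac : G.Adj a c) (hab : ¬ G.Adj a b) (hbc : ¬ G.Adj b c)
    (hbx : G.Adj b x) (hby : G.Adj b y) : False := by
  have hnd := hv.1
  have ad : ∀ k ∈ [a,b,c,x,y,z], G.Adj v k := fun k hk => (hv.2 k).2 hk
  have K : ∀ a' c' x' y' z', [a',b,c',x',y',z'].Perm [a,b,c,x,y,z] → ¬ G.Adj a' b → ¬ G.Adj b c' →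
      G.Adj b x' → G.Adj a' c' → ¬ G.Adj y' z' := by
    intro a' c' x' y' z' hp h1 h2 h3 h4 h5
    have h := hv.perm hp.symm
    exact T_6a hG h.nd h.2 h4 h3 h5 h1 h2
  have hyz := K a c x y z (.refl _) hab hbc hbx hac
  have hxz := K a c y x z pm hab hbc hby hac
  have hbz : ¬ G.Adj b z := by
    intro h
    have hxy := K a c z x y pm hab hbc h hac
    exact ex3 hG hv (by simp) x y z (by clear * - hnd; simp at hnd ⊢; grind) (ad _ (by simp)) (ad _ (by simp)) (ad _ (by simp)) hxy hxz hyz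
  have hza : G.Adj a z := by
    by_contra h
    exact ex3 hG hv (by simp) a b z (by clear * - hnd; simp at hnd ⊢; grind) (ad _ (by simp)) (ad _ (by simp)) (ad _ (by simp)) hab h hbz
  have hzc : G.Adj c z := by
    by_contra h
    exact ex3 hG hv (by simp) b c z (by clear * - hnd; simp at hnd ⊢; grind) (ad _ (by simp)) (ad _ (by simp)) (ad _ (by simp)) hbc hbz h
  have h1 := K a z y x c pm hab hbz hby hza
  have h2 := K c z y x a pm (fun h => hbc h.symm) hbz hby hzc
  exact T_6b hG hv.nd hv.2 hbx hab hbc hbz (fun h => h2 (h)) h1 hxz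

lemma cmatch [DecidableEq V] {G : SimpleGraph V} (hG : NoRed G) {v a b c : V} {l : List V}
    (hv : NB G v l) (hl : l.length = 5 ∨ l.length = 6) (hnd : [a,b,c].Nodup) (ha : G.Adj v a)
    (hb : G.Adj v b) (hc : G.Adj v c) (hab : ¬ G.Adj a b) (hbc : ¬ G.Adj b c) : False := by
  by_cases hac : G.Adj a c
  swap
  · exact ex3 hG hv (by omega) a b c hnd ha hb hc hab hac hbc
  obtain ⟨l', h, hlen⟩ := hv.ext [a,b,c] hnd (by simp [ha, hb, hc])
  have hba : ¬ G.Adj b a := fun h => hab h.symm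
  have ib := G.irrefl (v := b)
  rcases hl with hl | hl
  · obtain ⟨x, y, rfl⟩ := List.length_eq_two.1 (show l'.length = 2 by simp at hlen; omega)
    obtain ⟨z, hz, h1, h2⟩ := ex1 hG h b y hb
    simp at hz
    have : z = x := by grind
    subst this
    exact T_5 hG h.nd h.2 hac h1 hab hbc
  · obtain ⟨x, y, z, rfl⟩ := List.length_eq_three.1 (show l'.length = 3 by simp at hlen; omega)
    have e1 := ex1 hG h b x hb
    have e2 := ex1 hG h b y hb
    have e3 := ex1 hG h b z hb
    simp [hba, hbc] at e1 e2 e3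
    have k1 : ¬ (G.Adj b x ∧ G.Adj b y) := fun hh => cm6 hG h hac hab hbc hh.1 hh.2
    have k2 : ¬ (G.Adj b x ∧ G.Adj b z) := fun hh => 
      cm6 hG (h.perm (l' := [a,b,c,x,z,y]) pm) hac hab hbc hh.1 hh.2
    have k3 : ¬ (G.Adj b y ∧ G.Adj b z) := fun hh => 
      cm6 hG (h.perm (l' := [a,b,c,y,z,x]) pm) hac hab hbc hh.1 hh.2
    grind

lemma one5 [DecidableEq V] {G : SimpleGraph V} (hG : NoRed G) {v w x a b : V} {l : List V}
    (hv : NB G v l) (hl : l.length = 5) (hnd : [w,x,a,b].Nodup) (hw : G.Adj v w) (hx : G.Adj v x)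
    (ha : G.Adj v a) (hb : G.Adj v b) (hwx : ¬ G.Adj w x) : G.Adj a b := by
  by_contra hab
  obtain ⟨l', h, hlen⟩ := hv.ext [w,x,a,b] hnd (by simp [ha, hb, hx, hw])
  obtain ⟨c, rfl⟩ := List.length_eq_one_iff.1 (show l'.length = 1 by simp at hlen; omega)
  have hc : G.Adj v c := (h.2 c).2 (by simp)
  have M := fun p q r (hp : [p,q,r].Nodup) (h1 : G.Adj v p) (h2 : G.Adj v q) (h3 : G.Adj v r) h4 h5 => cmatch hG hv (.inl hl) hp h1 h2 h3 h4 h5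
  have nd := h.1
  have N : ∀ p q, p ∈ [w,x,a,b,c] → q ∈ [w,x,a,b,c] → p ≠ q → (p,q) ≠ (w,x) → (p,q) ≠ (x,w) →
     (p,q) ≠ (a,b) → (p,q) ≠ (b,a) → G.Adj p q := by
    intro p q hp hq hpq h1 h2 h3 h4
    by_contra hn
    have hn' : ¬ G.Adj q p := fun h => hn h.symm
    have i1 : ¬ G.Adj x w := fun h => hwx h.symm
    have i2 : ¬ G.Adj b a := fun h => hab h.symm
    have sub : ∀ p q r, p ∈ [w,x,a,b,c] → q ∈ [w,x,a,b,c] → r ∈ [w,x,a,b,c] → p ≠ q → p ≠ r → q ≠ r → ¬ G.Adj p q → ¬ G.Adj q r → False := by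
      intro p q r hp hq hr a1 a2 a3 a4 a5
      exact M p q r (by simp [a1, a2, a3]) ((h.2 p).2 hp) ((h.2 q).2 hq) ((h.2 r).2 hr) a4 a5
    simp only [List.cons_append, List.nil_append, List.nodup_cons, List.mem_cons, List.not_mem_nil, or_false, not_or] at nd
    clear M h hlen hv hG hnd
    have hp' := hp
    have hq' := hq
    simp only [List.mem_cons, List.not_mem_nil, or_false] at hp' hq'
    have s1 := sub w x
    have s2 := sub x w
    have s3 := sub a b
    have s4 := sub b a
    have s5 := sub p q
    simp only [List.mem_cons, List.not_mem_nil, or_false] at s1 s2 s3 s4 hp hq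
    rcases hp' with rfl | rfl | rfl | rfl | rfl
    · have := s2 q; grind
    · have := s1 q; grind
    · have := s4 q; grind
    · have := s3 q; grind
    · rcases hq' with rfl | rfl | rfl | rfl | rfl
      · have := s2 p; grind
      · have := s1 p; grind
      · have := s4 p; grind
      · have := s3 p; grind
      · grind
  simp only [List.cons_append, List.nil_append, List.nodup_cons, List.mem_cons, List.not_mem_nil, or_false, not_or] at nd
  refine T_5b hG h.nd h.2 ?_ ?_ ?_ ?_ ?_ ?_ ?_ ?_ hwx hab <;> apply N <;> first | simp; done | grind

def Low (n : ℕ) : Prop := n = 5 ∨ n = 6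

lemma low_struct [DecidableEq V] {G : SimpleGraph V} (hG : NoRed G) {v w : V} {l : List V}
    (hv : NB G v l) (hl : Low l.length) (hw : G.Adj v w) :
    (∃ B, NB G v (w :: B) ∧ B.length + 1 = l.length ∧ ∀ b ∈ B, G.Adj w b) ∨
    (∃ x B, NB G v (w :: x :: B) ∧ B.length + 2 = l.length ∧ ¬ G.Adj w x ∧ (∀ b ∈ B, G.Adj w b) ∧ ∀ b ∈ B, G.Adj x b) := by
  obtain ⟨B, hB, hlen⟩ := hv.ext [w] (by simp) (by simpa using hw)
  by_cases h : ∀ b ∈ B, G.Adj w b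
  · exact .inl ⟨B, hB, by simp at hlen; omega, h⟩
  push Not at h
  obtain ⟨x, hx, hwx⟩ := h
  have hvx := (hB.2 x).2 (by simp [hx])
  have hne : w ≠ x := by
    rintro rfl
    have := hB.1
    simp [hx] at this
  obtain ⟨B', hB', hlen'⟩ := hv.ext [w,x] (by simp [hne]) (by simp [hw, hvx])
  have hnd := hB'.1
  simp at hnd
  refine .inr ⟨x, B', hB', by simp at hlen'; omega, hwx, ?_, ?_⟩
  · intro b hb
    by_contra hwb
    exact cmatch hG hv hl (a := x) (b := w) (c := b) (by simp; grind) hvx hw ((hB'.2 b).2 (by simp [hb]))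
      (fun h => hwx h.symm) hwb
  · intro b hb
    by_contra hwb
    exact cmatch hG hv hl (a := w) (b := x) (c := b) (by simp; grind) hw hvx ((hB'.2 b).2 (by simp [hb]))
      hwx hwb

lemma cyc4 [DecidableEq V] {G : SimpleGraph V} (hG : NoRed G) {v : V} {l B : List V}
    (hv : NB G v l) (hl : Low l.length) (hB : ∀ b ∈ B, G.Adj v b) (hnd : B.Nodup) (h4 : B.length = 4) :
    ∃ a b c d, B.Perm [a,b,c,d] ∧ G.Adj a b ∧ G.Adj b c ∧ G.Adj c d ∧ G.Adj a d := by
  match B, h4 with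
  | [a,b,c,d], _ =>
  have M : ∀ p q r, p ∈ [a,b,c,d] → q ∈ [a,b,c,d] → r ∈ [a,b,c,d] → p ≠ q → p ≠ r → q ≠ r →
      G.Adj p q ∨ G.Adj q r := by
    intro p q r hp hq hr a1 a2 a3
    by_contra! hh
    exact cmatch hG hv hl (a := p) (b := q) (c := r) (by simp [a1,a2,a3]) (hB p hp) (hB q hq) (hB r hr) hh.1 hh.2
  simp only [List.nodup_cons, List.mem_cons, List.not_mem_nil, or_false, not_or] at hnd M
  have sy := fun x y => G.adj_comm x y
  by_cases h1 : G.Adj a b ∧ G.Adj c d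
  · by_cases h2 : G.Adj b c ∧ G.Adj a d
    · exact ⟨a,b,c,d, .refl _, h1.1, h2.1, h1.2, h2.2⟩
    · exact ⟨a,b,d,c, pm, by grind, by grind, by grind, by grind⟩
  · exact ⟨a,c,b,d, pm, by grind, by grind, by grind, by grind⟩

lemma cyc5 [DecidableEq V] {G : SimpleGraph V} (hG : NoRed G) {v : V} {l B : List V}
    (hv : NB G v l) (hl : Low l.length) (hB : ∀ b ∈ B, G.Adj v b) (hnd : B.Nodup) (h4 : B.length = 5) :
    ∃ a b c d e, B.Perm [a,b,c,d,e] ∧ G.Adj a b ∧ G.Adj c d ∧ G.Adj a c ∧ G.Adj b d := by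
  match B, h4 with
  | [e,a,b,c,d], _ =>
  obtain ⟨a', b', c', d', hp, h1, h2, h3, h4⟩ := cyc4 hG hv hl (B := [a,b,c,d]) (by simp at hB ⊢; grind) 
    (List.nodup_cons.1 hnd).2 rfl
  exact ⟨a', b', d', c', e, (hp.cons e).trans pm, h1, h3.symm, h4, h2⟩

lemma NB.mp {G : SimpleGraph V} {v : V} {l : List V} (h : NB G v l) {k : V} (hk : k ∈ l) : G.Adj v k := (h.2 k).2 hk

lemma low_indep [DecidableEq V] {G : SimpleGraph V} (hG : NoRed G) {u v : V} {l l' : List V}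
    (hu : NB G u l) (hl : Low l.length) (hv : NB G v l') (hl' : Low l'.length) : ¬ G.Adj u v := by
  intro huv
  have key : ∀ B B' : List V, B.Nodup → B'.Nodup → (∀ k, k ∈ B ↔ G.Adj u k ∧ G.Adj v k) →
     (∀ k, k ∈ B' ↔ G.Adj v k ∧ G.Adj u k) → B'.Perm B := by
    intro B B' h1 h2 h3 h4
    exact (List.perm_ext_iff_of_nodup h2 h1).2 (fun a => by rw [h3, h4, and_comm])
  have c1 : ∀ (u v : V) B, NB G u (v :: B) → (∀ b ∈ B, G.Adj v b) → ∀ k, k ∈ B ↔ G.Adj u k ∧ G.Adj v k := by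
    intro u v B h1 h2 k
    have := h1.2 k
    have i := G.irrefl (v := v)
    simp at this
    grind
  have c2 : ∀ (u v x : V) B, NB G u (v :: x :: B) → (∀ b ∈ B, G.Adj v b) → ¬ G.Adj v x → 
      ∀ k, k ∈ B ↔ G.Adj u k ∧ G.Adj v k := by
    intro u v x B h1 h2 h3 k
    have := h1.2 k
    have i := G.irrefl (v := v)
    simp at this
    grind
  -- case with one extra
  have one : ∀ (u v : V) (l l' : List V), NB G u l → Low l.length → NB G v l' → Low l'.length → ∀ x B B', NB G u (v :: x :: B) → B.length + 2 = l.length → ¬ G.Adj v x → (∀ b ∈ B, G.Adj v b) → 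
      NB G v (u :: B') → B'.length + 1 = l'.length → (∀ b ∈ B', G.Adj u b) → B'.Perm B → False := by
    intro u v l l' hu hl hv hl' x B B' h1 h2 h3 h4 h5 h6 h7 hp
    have := hp.length_eq
    have hB4 : B.length = 4 := by unfold Low at *; omega
    have hnd := (List.nodup_cons.1 (List.nodup_cons.1 h1.1).2).2
    obtain ⟨a, b, c, d, hq, k1, k2, k3, k4⟩ := cyc4 hG hu hl (B := B) (fun b hb => h1.mp (by simp [hb])) hnd hB4
    have h1' := h1.perm (l' := [v,a,b,c,d,x]) (((hq.cons x).cons v).trans pm)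
    have h5' := h5.perm (l' := [u,a,b,c,d]) ((hp.trans hq).cons u)
    exact T_C4x hG (u := u) (v := v) (h1'.nd) h1'.2 h5'.2 k1 k3 k2 k4
  rcases low_struct hG hu hl huv with ⟨B, h1, h2, h3⟩ | ⟨x, B, h1, h2, hn, h3, h3'⟩ <;>
  rcases low_struct hG hv hl' huv.symm with ⟨B', h4, h5, h6⟩ | ⟨y, B', h4, h5, hn', h6, h6'⟩
  · have hnd := (List.nodup_cons.1 h1.1).2
    have hp := key B B' hnd (List.nodup_cons.1 h4.1).2 (c1 _ _ _ h1 h3) (c1 _ _ _ h4 h6)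
    have hlen := hp.length_eq
    rcases hl with hl | hl
    · obtain ⟨a, b, c, d, hq, k1, k2, k3, k4⟩ := cyc4 hG hu (.inl hl) (B := B) (fun b hb => h1.mp (by simp [hb])) hnd (by omega)
      have h1' := h1.perm (hq.cons v)
      have h4' := h4.perm ((hp.trans hq).cons u)
      exact T_C4 hG (u := u) (v := v) (h1'.nd) h1'.2 h4'.2 k1 k3 k2 k4
    · obtain ⟨a, b, c, d, e, hq, k1, k2, k3, k4⟩ := cyc5 hG hu (.inr hl) (B := B) (fun b hb => h1.mp (by simp [hb])) hnd (by omega)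
      have h1' := h1.perm (hq.cons v)
      have h4' := h4.perm ((hp.trans hq).cons u)
      exact T_C5 hG (u := u) (v := v) (h1'.nd) h1'.2 h4'.2 k1 k2 k3 k4
  · have hnd := (List.nodup_cons.1 h1.1).2
    have hnd' := (List.nodup_cons.1 (List.nodup_cons.1 h4.1).2).2
    have hp := key B B' hnd hnd' (c1 _ _ _ h1 h3) (c2 _ _ _ _ h4 h6 hn')
    exact one v u l' l hv hl' hu hl y B' B h4 h5 hn' h6 h1 h2 h3 hp.symm
  · have hnd := (List.nodup_cons.1 (List.nodup_cons.1 h1.1).2).2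
    have hp := key B B' hnd (List.nodup_cons.1 h4.1).2 (c2 _ _ _ _ h1 h3 hn) (c1 _ _ _ h4 h6)
    exact one u v l l' hu hl hv hl' x B B' h1 h2 hn h3 h4 h5 h6 hp
  · have hnd := (List.nodup_cons.1 (List.nodup_cons.1 h1.1).2).2
    have hnd' := (List.nodup_cons.1 (List.nodup_cons.1 h4.1).2).2
    have hp := key B B' hnd hnd' (c2 _ _ _ _ h1 h3 hn) (c2 _ _ _ _ h4 h6 hn')
    have hlen := hp.length_eq
    have hxy : x ≠ y := by
      rintro rfl
      exact hn (h4.mp (by simp))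
    rcases hl with hl | hl
    · obtain ⟨a, b, c, rfl⟩ := List.length_eq_three.1 (show B.length = 3 by omega)
      have h1' := h1.perm (l' := [v,a,b,c,x]) pm
      have h4' := h4.perm (l' := [u,a,b,c,y]) ((((hp).cons y).cons u).trans pm)
      have nd1 := h1'.nd
      have nd2 := h4'.nd
      have A := fun k hk => h1'.mp (k := k) hk
      have hbc := one5 hG hu hl (w := v) (x := x) (a := b) (b := c) (by clear * - nd1; simp at nd1 ⊢; grind) huv (A _ (by simp)) (A _ (by simp)) (A _ (by simp)) hn
      have hac := one5 hG hu hl (w := v) (x := x) (a := a) (b := c) (by clear * - nd1; simp at nd1 ⊢; grind) huv (A _ (by simp)) (A _ (by simp)) (A _ (by simp)) hn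
      refine T_C3 hG (u := u) (v := v) (x := x) (y := y) ?_ h1'.2 h4'.2 (h3' a (by simp)).symm hbc
        (h6' b (hp.mem_iff.2 (by simp))).symm hac
      clear * - nd1 nd2 hxy
      simp at nd1 nd2 ⊢
      grind
    · obtain ⟨a, b, c, d, hq, k1, k2, k3, k4⟩ := cyc4 hG hu (.inr hl) (B := B) (fun b hb => h1.mp (by simp [hb])) hnd (by omega)
      have h1' := h1.perm (l' := [v,a,b,c,d,x]) (((hq.cons x).cons v).trans pm)
      have h4' := h4.perm (l' := [u,a,b,c,d,y]) ((((hp.trans hq).cons y).cons u).trans pm)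
      have nd1 := h1'.nd
      have nd2 := h4'.nd
      refine T_C4xy hG (u := u) (v := v) (x := x) (y := y) ?_ h1'.2 h4'.2 (h3' a (hq.mem_iff.2 (by simp))).symm k3
        (h6' c ((hp.trans hq).mem_iff.2 (by simp))).symm k4
      clear * - nd1 nd2 hxy
      simp at nd1 nd2 ⊢
      grind

lemma caseA [DecidableEq V] {G : SimpleGraph V} (hG : NoRed G) {v w a b c d p q : V}
    (hv : NB G v [w,a,b,c,d]) (hw : NB G w [v,a,b,c,d,p,q]) (hab : G.Adj a b) (hbc : G.Adj b c)
    (hcd : G.Adj c d) (had : G.Adj a d) : False := by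
  have nd := hw.nd
  have hnd : [v,w,a,b,c,d,p,q].Nodup := (pm (l := [w,v,a,b,c,d,p,q])).nodup_iff.1 nd
  by_cases hbd : G.Adj b d
  swap
  · exact T_A1 hG hnd hv.2 hw.2 hab hcd hbc had hbd
  by_cases hac : G.Adj a c
  swap
  · have hv' := hv.perm (l' := [w,b,c,d,a]) pm
    have hw' := hw.perm (l' := [v,b,c,d,a,p,q]) pm
    exact T_A1 hG ((pm (l := [w,v,a,b,c,d,p,q])).nodup_iff.1 nd) hv'.2 hw'.2 hbc had.symm hcd hab.symm (fun h => hac h.symm)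
  by_cases hpq : G.Adj p q
  · exact T_A2 hG hnd hv.2 hw.2 hab hcd hbc had hpq
  obtain ⟨z, hz, h1, -⟩ := ex1 hG hw q q (hw.mp (by simp))
  have hvq : ¬ G.Adj q v := by
    intro h
    have := (hv.2 q).1 h.symm
    clear * - hnd this
    simp at hnd this
    grind
  simp only [List.mem_cons, List.not_mem_nil, or_false] at hz
  rcases hz with rfl | rfl | rfl | rfl | rfl | rfl | rfl
  · exact hvq h1
  · have hv' := hv.perm (l' := [w,b,c,z,d]) pm
    have hw' := hw.perm (l' := [v,b,c,z,d,p,q]) pm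
    exact T_A3 hG ((pm (l := [w,v,z,b,c,d,p,q])).nodup_iff.1 nd) hv'.2 hw'.2 hbc hab.symm hac.symm had hcd h1.symm
  · have hv' := hv.perm (l' := [w,a,c,z,d]) pm
    have hw' := hw.perm (l' := [v,a,c,z,d,p,q]) pm
    exact T_A3 hG ((pm (l := [w,v,a,z,c,d,p,q])).nodup_iff.1 nd) hv'.2 hw'.2 hac hab hbc.symm hbd hcd h1.symm
  · exact T_A3 hG hnd hv.2 hw.2 hab hac hbc hcd hbd h1.symm
  · have hv' := hv.perm (l' := [w,a,b,z,c]) pm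
    have hw' := hw.perm (l' := [v,a,b,z,c,p,q]) pm
    exact T_A3 hG ((pm (l := [w,v,a,b,c,z,p,q])).nodup_iff.1 nd) hv'.2 hw'.2 hab had hbd hcd.symm hbc h1.symm
  · exact hpq h1.symm
  · exact G.irrefl h1

structure SB (G : SimpleGraph V) (v w x a b c p q r : V) : Prop where
  hv : NB G v [w,a,b,c,x]
  hw : NB G w [v,a,b,c,p,q,r]
  nwx : ¬ G.Adj w x
  hab : G.Adj a b
  hac : G.Adj a c
  hbc : G.Adj b c
  hax : G.Adj a x
  hbx : G.Adj b x
  hcx : G.Adj c x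

namespace SB
variable [DecidableEq V] {G : SimpleGraph V} {v w x a b c p q r : V}

lemma ab (h : SB G v w x a b c p q r) : SB G v w x b a c p q r :=
  ⟨h.hv.perm pm, h.hw.perm pm, h.nwx, h.hab.symm, h.hbc, h.hac, h.hbx, h.hax, h.hcx⟩

lemma bc (h : SB G v w x a b c p q r) : SB G v w x a c b p q r :=
  ⟨h.hv.perm pm, h.hw.perm pm, h.nwx, h.hac, h.hab, h.hbc.symm, h.hax, h.hcx, h.hbx⟩

lemma pq (h : SB G v w x a b c p q r) : SB G v w x a b c q p r :=
  ⟨h.hv, h.hw.perm pm, h.nwx, h.hab, h.hac, h.hbc, h.hax, h.hbx, h.hcx⟩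

lemma qr (h : SB G v w x a b c p q r) : SB G v w x a b c p r q :=
  ⟨h.hv, h.hw.perm pm, h.nwx, h.hab, h.hac, h.hbc, h.hax, h.hbx, h.hcx⟩

lemma nd (h : SB G v w x a b c p q r) : [v,w,a,b,c,x,p,q,r].Nodup := by
  have n1 := h.hv.nd
  have n2 := h.hw.nd
  have n3 := h.nwx
  have h1 := h.hw.2 x
  clear h
  simp at n1 n2 h1 ⊢
  grind

lemma vp (h : SB G v w x a b c p q r) : ¬ G.Adj p v := by
  have n1 := h.nd
  intro h'
  have := (h.hv.2 p).1 h'.symm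
  clear * - n1 this
  simp at n1 this
  grind

lemma B0 (hG : NoRed G) (h : SB G v w x a b c p q r) (npq : ¬ G.Adj p q) (npr : ¬ G.Adj p r)
    (nqr : ¬ G.Adj q r) : False := by
  have vp := h.vp
  have vq := h.pq.vp
  have wp : G.Adj w p := h.hw.mp (by simp)
  have wq : G.Adj w q := h.hw.mp (by simp)
  have nqp : ¬ G.Adj q p := fun h => npq h.symm
  have ip := G.irrefl (v := p)
  have iq := G.irrefl (v := q)
  obtain ⟨y, hy, y1, -⟩ := ex1 hG h.hw p p wp
  obtain ⟨z, hz, z1, z2⟩ := ex1 hG h.hw q y wq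
  have B1 : ∀ a b c, SB G v w x a b c p q r → G.Adj p a → G.Adj q b → False :=
    fun a b c h h1 h2 => T_B1 hG h.nd h.hv.2 h.hw.2 h1.symm h2.symm npq npr nqr
  have hy' : y = a ∨ y = b ∨ y = c := by
    simp only [List.mem_cons, List.not_mem_nil, or_false] at hy
    rcases hy with rfl | rfl | rfl | rfl | rfl | rfl | rfl <;> tauto
  have hz' : z = a ∨ z = b ∨ z = c := by
    simp only [List.mem_cons, List.not_mem_nil, or_false] at hz
    rcases hz with rfl | rfl | rfl | rfl | rfl | rfl | rfl <;> tauto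
  clear hy hz
  rcases hy' with rfl | rfl | rfl <;> rcases hz' with rfl | rfl | rfl
  · exact z2 rfl
  · exact B1 _ _ _ h y1 z1
  · exact B1 _ _ _ h.bc y1 z1
  · exact B1 _ _ _ h.ab y1 z1
  · exact z2 rfl
  · exact B1 _ _ _ h.ab.bc y1 z1
  · exact B1 _ _ _ h.bc.ab y1 z1
  · exact B1 _ _ _ h.bc.ab.bc y1 z1
  · exact z2 rfl

lemma two (hG : NoRed G) (h : SB G v w x a b c p q r) (hpq : G.Adj p q) (hpr : G.Adj p r)
    (nqr : ¬ G.Adj q r) : False := by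
  have Z1 : ∀ a b c, SB G v w x a b c p q r → (G.Adj a q ↔ G.Adj a r) := by
    intro a b c h
    constructor
    · intro h1
      by_contra h2
      exact T_Z1 hG h.qr.nd h.qr.hv.2 h.qr.hw.2 h1 h.hbx hpr (fun h => nqr h.symm) h2
    · intro h1
      by_contra h2
      exact T_Z1 hG h.nd h.hv.2 h.hw.2 h1 h.hbx hpq nqr h2
  have Z3 : ∀ a b c, SB G v w x a b c p q r → G.Adj a q → G.Adj b r → G.Adj c q := by
    intro a b c h h1 h2
    by_contra h3
    exact T_Z3 hG h.nd h.hv.2 h.hw.2 h1 h2 h3 (fun h4 => h3 ((Z1 _ _ _ h.bc.ab).2 h4)) nqr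
  have a1 := Z1 _ _ _ h
  have b1 := Z1 _ _ _ h.ab
  have c1 := Z1 _ _ _ h.bc.ab
  by_cases hall : G.Adj a q ∧ G.Adj b q ∧ G.Adj c q
  · obtain ⟨h1, h2, h3⟩ := hall
    exact T_Z2 hG h.nd h.hv.2 h.hw.2 h.hab h.hac (c1.1 h3) (a1.1 h1) h1 h.hbc h3 h2 (b1.1 h2) nqr
  have z1 := Z3 _ _ _ h
  have z2 := Z3 _ _ _ h.bc
  have z3 := Z3 _ _ _ h.ab.bc
  have vq := h.pq.vp
  have vr := h.qr.pq.vp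
  have nrq : ¬ G.Adj r q := fun h => nqr h.symm
  have iq := G.irrefl (v := q)
  have ir := G.irrefl (v := r)
  have E := fun i => exI hG h.hw [q,r] [p,i] (by have := h.nd; clear * - this; simp at this ⊢; grind) (by simp)
    (fun k hk => h.hw.mp (by simp at hk ⊢; grind)) (by simp [nqr]) (by simp)
  have ea := E a
  have eb := E b
  have ec := E c
  simp [vq, vr, nrq, nqr, G.adj_comm q a, G.adj_comm q b, G.adj_comm q c, G.adj_comm r a, G.adj_comm r b, G.adj_comm r c] at ea eb ec
  grind

lemma triP (hG : NoRed G) (h : SB G v w x a b c p q r) (hqr : G.Adj q r) : G.Adj a p ∧ G.Adj b p ∧ G.Adj c p := by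
  have Mix : ∀ a b c, SB G v w x a b c p q r → G.Adj a p → G.Adj b p := by
    intro a b c h h1
    by_contra h2
    exact T_Mix hG h.nd h.hv.2 h.hw.2 h.hab h1 h.hbc h.hcx hqr h2
  have z : ¬ (¬ G.Adj a p ∧ ¬ G.Adj b p ∧ ¬ G.Adj c p) := by
    rintro ⟨h1, h2, h3⟩
    exact T_Z4 hG h.nd h.hv.2 h.hw.2 h.hab h.hbx h.hax h.hac h.hcx hqr h1 h2 h3
  have m1 := Mix _ _ _ h
  have m2 := Mix _ _ _ h.bc
  have m3 := Mix _ _ _ h.ab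
  have m4 := Mix _ _ _ h.bc.ab
  tauto

lemma final (hG : NoRed G) (h : SB G v w x a b c p q r) : [a,b,c,p,q,r].Pairwise G.Adj := by
  have t1 := h.triP hG
  have t2 := h.pq.triP hG
  have t3 := h.qr.pq.triP hG
  have k0 := h.B0 hG
  have w1 := h.two hG
  have w2 := h.pq.two hG
  have w3 := h.qr.pq.two hG
  have B2 : ∀ p q r, SB G v w x a b c p q r → G.Adj p q → ¬ G.Adj p r → ¬ G.Adj q r → False :=
    fun p q r h h1 h2 h3 => T_B2 hG h.nd h.hv.2 h.hw.2 h.hac h1 h2 h3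
  have b1 := B2 _ _ _ h
  have b2 := B2 _ _ _ h.qr
  have b3 := B2 _ _ _ h.pq.qr
  have s1 := G.adj_comm q p
  have s2 := G.adj_comm r p
  have s3 := G.adj_comm r q
  have c1 := h.hab
  have c2 := h.hac
  have c3 := h.hbc
  have : G.Adj p q ∧ G.Adj p r ∧ G.Adj q r := by grind
  simp only [List.pairwise_cons, List.mem_cons, List.not_mem_nil, or_false, forall_eq_or_imp, forall_eq, List.Pairwise.nil]
  simp
  grind

end SB

lemma caseD1 [DecidableEq V] {G : SimpleGraph V} (hG : NoRed G) {v w a b c d x p q : V}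
    (hv : NB G v [w,a,b,c,d,x]) (hw : NB G w [v,a,b,c,d,p,q]) (hab : G.Adj a b) (hbc : G.Adj b c)
    (hcd : G.Adj c d) (had : G.Adj a d) (hax : G.Adj a x) (hcx : G.Adj c x)
    (hnd : [v,w,a,b,c,d,x,p,q].Nodup) (hac : G.Adj a c) : False := by
  by_cases hpq : G.Adj p q
  · exact T_D2 hG hnd hv.2 hw.2 hab hac hcd had hbc hcx hpq
  have hv' := hv.perm (l' := [w,c,b,a,d,x]) pm
  have hw' := hw.perm (l' := [v,c,b,a,d,p,q]) pm
  have nd' : [v,w,c,b,a,d,x,p,q].Nodup := (pm (l := [v,w,a,b,c,d,x,p,q])).nodup_iff.1 hnd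
  have n1 : ¬ G.Adj p a := fun h => T_D3 hG hnd hv.2 hw.2 hab hac hcd had h.symm hbc hcx
  have n2 : ¬ G.Adj p c := fun h => T_D3 hG nd' hv'.2 hw'.2 hbc.symm hac.symm had hcd h.symm hab.symm hax
  have hwq := hw.perm (l' := [v,a,b,c,d,q,p]) pm
  have hwq' := hw.perm (l' := [v,c,b,a,d,q,p]) pm
  have n3 : ¬ G.Adj q a := fun h => T_D3 hG ((pm (l := [v,w,a,b,c,d,x,p,q])).nodup_iff.1 hnd) hv.2 hwq.2 hab hac hcd had h.symm hbc hcx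
  have n4 : ¬ G.Adj q c := fun h => T_D3 hG ((pm (l := [v,w,a,b,c,d,x,p,q])).nodup_iff.1 hnd) hv'.2 hwq'.2 hbc.symm hac.symm had hcd h.symm hab.symm hax
  have v1 : ¬ G.Adj p v := by
    intro h; have := (hv.2 p).1 h.symm; clear * - hnd this; simp at hnd this; grind
  have v2 : ¬ G.Adj q v := by
    intro h; have := (hv.2 q).1 h.symm; clear * - hnd this; simp at hnd this; grind
  have hqp : ¬ G.Adj q p := fun h => hpq h.symm
  have E := exI hG hw [p,q] [b,d] (by clear * - hnd; simp at hnd ⊢; grind) (by simp)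
    (fun k hk => hw.mp (by simp at hk ⊢; grind)) (by simp [hpq]) (by simp)
  simp [n1, n2, n3, n4, v1, v2, hpq, hqp] at E

lemma caseD [DecidableEq V] {G : SimpleGraph V} (hG : NoRed G) {v w a b c d x p q : V}
    (hv : NB G v [w,a,b,c,d,x]) (hw : NB G w [v,a,b,c,d,p,q]) (hab : G.Adj a b) (hbc : G.Adj b c)
    (hcd : G.Adj c d) (had : G.Adj a d) (hx : ∀ k ∈ [a,b,c,d], G.Adj k x) (nwx : ¬ G.Adj w x) : False := by
  have hnd : [v,w,a,b,c,d,x,p,q].Nodup := by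
    have n1 := hv.nd
    have n2 := hw.nd
    have h1 := hw.2 x
    clear * - n1 n2 nwx h1
    simp at n1 n2 h1 ⊢
    grind
  by_cases hac : G.Adj a c
  · exact caseD1 hG hv hw hab hbc hcd had (hx a (by simp)) (hx c (by simp)) hnd hac
  by_cases hbd : G.Adj b d
  · exact caseD1 hG (a := b) (b := c) (c := d) (d := a) (hv.perm pm) (hw.perm pm) hbc hcd had.symm hab.symm
      (hx b (by simp)) (hx d (by simp)) ((pm (l := [v,w,a,b,c,d,x,p,q])).nodup_iff.1 hnd) hbd
  exact T_D1 hG hnd hv.2 hw.2 hab had hbc hcd hac hbd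

lemma low7 [DecidableEq V] {G : SimpleGraph V} (hG : NoRed G) {v w : V} {l l' : List V}
    (hv : NB G v l) (hl : Low l.length) (hw : NB G w l') (hl' : l'.length = 7) (hvw : G.Adj v w) :
    l.length = 5 ∧ ∃ x a b c p q r, SB G v w x a b c p q r := by
  rcases low_struct hG hv hl hvw with ⟨B, h1, h2, h3⟩ | ⟨x, B, h1, h2, hn, h3, h3'⟩
  · exfalso
    have hnd := List.nodup_cons.1 h1.1
    have hvB : v ∉ B := fun h => G.irrefl (h1.mp (by simp [h]))
    obtain ⟨P, hP, hlen⟩ := hw.ext (v :: B) (List.nodup_cons.2 ⟨hvB, hnd.2⟩) (by simpa [hvw.symm] using h3)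
    rw [List.length_cons] at hlen
    rcases hl with hl | hl
    · obtain ⟨a, b, c, d, hq, k1, k2, k3, k4⟩ := cyc4 hG hv (.inl hl) (B := B) (fun b hb => h1.mp (by simp [hb])) hnd.2 (by omega)
      obtain ⟨p, q, rfl⟩ := List.length_eq_two.1 (show P.length = 2 by omega)
      exact caseA hG (h1.perm (hq.cons w)) (hP.perm ((hq.append_right _).cons v)) k1 k2 k3 k4
    · obtain ⟨a, b, c, d, e, hq, k1, k2, k3, k4⟩ := cyc5 hG hv (.inr hl) (B := B) (fun b hb => h1.mp (by simp [hb])) hnd.2 (by omega)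
      obtain ⟨p, rfl⟩ := List.length_eq_one_iff.1 (show P.length = 1 by omega)
      have h1' := h1.perm (hq.cons w)
      have hP' := hP.perm (l' := [v,a,b,c,d,e,p]) ((hq.append_right _).cons v)
      exact T_C7 hG ((pm (l := [w,v,a,b,c,d,e,p])).nodup_iff.1 hP'.nd) h1'.2 hP'.2 k1 k2 k3 k4
  · have hnd := List.nodup_cons.1 (List.nodup_cons.1 h1.1).2
    have hvB : v ∉ B := fun h => G.irrefl (h1.mp (by simp [h]))
    obtain ⟨P, hP, hlen⟩ := hw.ext (v :: B) (List.nodup_cons.2 ⟨hvB, hnd.2⟩) (by simpa [hvw.symm] using h3)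
    rw [List.length_cons] at hlen
    rcases hl with hl | hl
    · refine ⟨hl, x, ?_⟩
      obtain ⟨a, b, c, rfl⟩ := List.length_eq_three.1 (show B.length = 3 by omega)
      obtain ⟨p, q, r, rfl⟩ := List.length_eq_three.1 (show P.length = 3 by omega)
      have nd1 := h1.nd
      have A := fun k hk => h1.mp (k := k) hk
      have O := fun s t h hs ht => one5 hG hv hl (w := w) (x := x) (a := s) (b := t) h hvw (A _ (by simp)) (A _ hs) (A _ ht) hn
      exact ⟨a, b, c, p, q, r, h1.perm pm, hP, hn, O a b (by clear * - nd1; simp at nd1 ⊢; grind) (by simp) (by simp),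
        O a c (by clear * - nd1; simp at nd1 ⊢; grind) (by simp) (by simp),
        O b c (by clear * - nd1; simp at nd1 ⊢; grind) (by simp) (by simp),
        (h3' a (by simp)).symm, (h3' b (by simp)).symm, (h3' c (by simp)).symm⟩
    · exfalso
      obtain ⟨a, b, c, d, hq, k1, k2, k3, k4⟩ := cyc4 hG hv (.inr hl) (B := B) (fun b hb => h1.mp (by simp [hb])) hnd.2 (by omega)
      obtain ⟨p, q, rfl⟩ := List.length_eq_two.1 (show P.length = 2 by omega)
      exact caseD hG (h1.perm (((hq.cons x).cons w).trans pm)) (hP.perm ((hq.append_right _).cons v)) k1 k2 k3 k4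
        (fun k hk => (h3' k (hq.mem_iff.2 hk)).symm) hn

lemma common4 [DecidableEq V] {G : SimpleGraph V} (hG : NoRed G) {u v a b c d p : V} {l : List V}
    (hv : NB G v [a,b,c,d,p]) (hu : NB G u l) (hl : l.length = 5) (huv : u ≠ v)
    (hA : ∀ k ∈ [a,b,c,d], G.Adj u k) : False := by
  have nuv := low_indep hG hu (.inl hl) hv (.inl rfl)
  have nd0 := hv.1
  have nd4 : [a,b,c,d].Nodup := by clear * - nd0; simp at nd0 ⊢; grind
  obtain ⟨Q, hQ, hlen⟩ := hu.ext [a,b,c,d] nd4 hA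
  obtain ⟨q, rfl⟩ := List.length_eq_one_iff.1 (show Q.length = 1 by simp at hlen; omega)
  obtain ⟨a', b', c', d', hp, h1, h2, h3, h4⟩ := cyc4 hG hv (.inl rfl) (B := [a,b,c,d]) 
    (fun k hk => hv.mp (by simp at hk ⊢; grind)) nd4 rfl
  have hv' := hv.perm (l' := [a',b',c',d',p]) (hp.append_right [p])
  have hu' := hQ.perm (l' := [a',b',c',d',q]) (hp.append_right [q])
  have n1 := hv'.nd
  have n2 := hu'.nd
  by_cases hpq : p = q
  · subst hpq
    refine T_Q5 hG (u := u) (v := v) ?_ hv'.2 hu'.2 h1 h3 h2 h4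
    clear * - n1 n2 huv
    simp at n1 n2 ⊢
    grind
  · have hup : u ≠ p := by
      rintro rfl
      exact nuv (hv.mp (by simp)).symm
    have hvq : v ≠ q := by
      rintro rfl
      exact nuv (hQ.mp (by simp))
    refine T_Q4 hG (u := u) (v := v) (p := p) (q := q) ?_ hv'.2 hu'.2 h1 h3 h2 h4
    clear * - n1 n2 huv hpq hup hvq
    simp at n1 n2 ⊢
    grind

lemma common3 [DecidableEq V] {G : SimpleGraph V} (hG : NoRed G) {u v w b c x y s t : V}
    (hv : NB G v [w,b,c,x,y]) (hu : NB G u [w,b,c,s,t]) (hnd : [u,v,w,b,c,x,y,s,t].Nodup) : G.Adj w x := by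
  by_contra nwx
  have M := fun p q r h hp hq hr h1 h2 => cmatch hG hv (.inl rfl) (a := p) (b := q) (c := r) h (hv.mp hp) (hv.mp hq) (hv.mp hr) h1 h2
  have hbc : G.Adj b c := one5 hG hv rfl (w := w) (x := x) (by clear * - hnd; simp at hnd ⊢; grind) (hv.mp (by simp)) (hv.mp (by simp)) (hv.mp (by simp)) (hv.mp (by simp)) nwx
  have nxw : ¬ G.Adj x w := fun h => nwx h.symm
  have hwb : G.Adj w b := by
    by_contra h
    exact M x w b (by clear * - hnd; simp at hnd ⊢; grind) (by simp) (by simp) (by simp) nxw h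
  have hwc : G.Adj w c := by
    by_contra h
    exact M x w c (by clear * - hnd; simp at hnd ⊢; grind) (by simp) (by simp) (by simp) nxw h
  have hxb : G.Adj x b := by
    by_contra h
    exact M w x b (by clear * - hnd; simp at hnd ⊢; grind) (by simp) (by simp) (by simp) nwx h
  have hxc : G.Adj x c := by
    by_contra h
    exact M w x c (by clear * - hnd; simp at hnd ⊢; grind) (by simp) (by simp) (by simp) nwx h
  have hxy : G.Adj x y := by
    by_contra h
    exact M w x y (by clear * - hnd; simp at hnd ⊢; grind) (by simp) (by simp) (by simp) nwx h
  by_cases hcs : G.Adj c s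
  · exact T_P3 hG hnd hv.2 hu.2 hbc hxc.symm hxb.symm hwb hcs hwc hxy nwx
  by_cases hct : G.Adj c t
  · exact T_P3 hG ((pm (l := [u,v,w,b,c,x,y,s,t])).nodup_iff.1 hnd) hv.2 (hu.perm (l' := [w,b,c,t,s]) pm).2 hbc hxc.symm hxb.symm hwb hct hwc hxy nwx
  exact cmatch hG hu (.inl rfl) (a := s) (b := c) (c := t) (by clear * - hnd; simp at hnd ⊢; grind) (hu.mp (by simp)) (hu.mp (by simp)) (hu.mp (by simp)) (fun h => hcs h.symm) hct

lemma pair5 [DecidableEq V] {G : SimpleGraph V} (hG : NoRed G) {u v v3 w b c : V} {lu lv l3 lw : List V}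
    (hu : NB G u lu) (hlu : lu.length = 5) (hv : NB G v lv) (hlv : lv.length = 5) 
    (h3 : NB G v3 l3) (hl3 : l3.length = 5) (hw : NB G w lw) (hlw : lw.length = 8)
    (hd : [u,v,v3].Nodup) (wu : G.Adj w u) (wv : G.Adj w v) (w3 : G.Adj w v3) (hbc : b ≠ c)
    (wb : G.Adj w b) (wc : G.Adj w c) (ub : G.Adj u b) (uc : G.Adj u c) (vb : G.Adj v b) (vc : G.Adj v c) : False := by
  have nd3 : [w,b,c].Nodup := by
    have i := wb.ne
    have j := wc.ne
    simp [i, j, hbc]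
  have nuv := low_indep hG hu (.inl hlu) hv (.inl hlv)
  have nu3 := low_indep hG hu (.inl hlu) h3 (.inl hl3)
  have nv3 := low_indep hG hv (.inl hlv) h3 (.inl hl3)
  obtain ⟨X, hX, hlX⟩ := hv.ext [w,b,c] nd3 (by simp [wv.symm, vb, vc])
  obtain ⟨S, hS, hlS⟩ := hu.ext [w,b,c] nd3 (by simp [wu.symm, ub, uc])
  obtain ⟨x, y, rfl⟩ := List.length_eq_two.1 (show X.length = 2 by simp at hlX; omega)
  obtain ⟨s, t, rfl⟩ := List.length_eq_two.1 (show S.length = 2 by simp at hlS; omega)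
  have huv : u ≠ v := by simp at hd; tauto
  have nux : ¬ G.Adj u x := fun h => common4 hG (hX.perm (l' := [w,b,c,x,y]) (.refl _)) hu hlu huv (by simp [wu.symm, ub, uc, h])
  have nuy : ¬ G.Adj u y := fun h => common4 hG (hX.perm (l' := [w,b,c,y,x]) pm) hu hlu huv (by simp [wu.symm, ub, uc, h])
  have n1 := hX.nd
  have n2 := hS.nd
  have us := hS.mp (k := s) (by simp)
  have ut := hS.mp (k := t) (by simp)
  have vx := hX.mp (k := x) (by simp)
  have vy := hX.mp (k := y) (by simp)
  have hnd : [u,v,w,b,c,x,y,s,t].Nodup := by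
    have d1 : x ≠ s := fun h => nux (h ▸ us)
    have d2 : x ≠ t := fun h => nux (h ▸ ut)
    have d3 : y ≠ s := fun h => nuy (h ▸ us)
    have d4 : y ≠ t := fun h => nuy (h ▸ ut)
    have d5 : u ≠ x := fun h => nuv (h ▸ vx.symm)
    have d6 : u ≠ y := fun h => nuv (h ▸ vy.symm)
    have d7 : v ≠ s := fun h => nuv (h ▸ us)
    have d8 : v ≠ t := fun h => nuv (h ▸ ut)
    clear * - n1 n2 d1 d2 d3 d4 d5 d6 d7 d8 huv
    simp at n1 n2 ⊢
    grind
  have P := fun (l : List V) (h : [u,v,w,b,c,x,y,s,t].Perm l) => h.nodup_iff.1 hnd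
  have wx := common3 hG hX hS hnd
  have wy := common3 hG (hX.perm (l' := [w,b,c,y,x]) pm) hS (P _ pm)
  have ws := common3 hG hS hX (P _ pm)
  have wt := common3 hG (hS.perm (l' := [w,b,c,t,s]) pm) hX (P _ pm)
  have e : ∀ k, G.Adj u k ∨ G.Adj v k → v3 ≠ k := by
    rintro k h rfl
    tauto
  obtain ⟨L, -, hL⟩ := hw.ext [u,v,v3,b,c,x,y,s,t] (by
    have e1 := e b (.inl ub)
    have e2 := e c (.inl uc)
    have e3 := e x (.inr vx)
    have e4 := e y (.inr vy)
    have e5 := e s (.inl us)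
    have e6 := e t (.inl ut)
    clear * - hnd hd e1 e2 e3 e4 e5 e6
    simp at hnd hd ⊢
    grind) (by simp [wx, wy, ws, wt, wb, wc, w3, wu, wv])
  simp at hL
  omega

lemma three5 [DecidableEq V] {G : SimpleGraph V} (hG : NoRed G) {u v v3 w : V} {lu lv l3 lw : List V}
    (hu : NB G u lu) (hlu : lu.length = 5) (hv : NB G v lv) (hlv : lv.length = 5) 
    (h3 : NB G v3 l3) (hl3 : l3.length = 5) (hw : NB G w lw) (hlw : lw.length = 8)
    (hd : [u,v,v3].Nodup) (wu : G.Adj w u) (wv : G.Adj w v) (w3 : G.Adj w v3) : False := by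
  have nuv := low_indep hG hu (.inl hlu) hv (.inl hlv)
  have nu3 := low_indep hG hu (.inl hlu) h3 (.inl hl3)
  have nv3 := low_indep hG hv (.inl hlv) h3 (.inl hl3)
  obtain ⟨A, hA, hlA⟩ := hw.ext [u,v,v3] hd (by simp [wu, wv, w3])
  have ex : ∀ (v : V) (l : List V), NB G v l → l.length = 5 → G.Adj w v → 
      ∃ S : Finset V, 3 ≤ S.card ∧ ∀ b ∈ S, G.Adj v b ∧ G.Adj w b := by
    intro v l hv hl hvw
    rcases low_struct hG hv (.inl hl) hvw.symm with ⟨B, h1, h2, h3⟩ | ⟨x, B, h1, h2, hn, h3, h3'⟩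
    · refine ⟨B.toFinset, ?_, ?_⟩
      · rw [List.toFinset_card_of_nodup (List.nodup_cons.1 h1.1).2]; omega
      · intro b hb
        rw [List.mem_toFinset] at hb
        exact ⟨h1.mp (by simp [hb]), h3 b hb⟩
    · refine ⟨B.toFinset, ?_, ?_⟩
      · rw [List.toFinset_card_of_nodup (List.nodup_cons.1 (List.nodup_cons.1 h1.1).2).2]; omega
      · intro b hb
        rw [List.mem_toFinset] at hb
        exact ⟨h1.mp (by simp [hb]), h3 b hb⟩
  obtain ⟨S1, c1, s1⟩ := ex u lu hu hlu wu
  obtain ⟨S2, c2, s2⟩ := ex v lv hv hlv wv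
  obtain ⟨S3, c3, s3⟩ := ex v3 l3 h3 hl3 w3
  have i12 : (S1 ∩ S2).card ≤ 1 := by
    by_contra! h
    obtain ⟨b, hb, c, hc, hbc⟩ := Finset.one_lt_card.1 h
    rw [Finset.mem_inter] at hb hc
    exact pair5 hG hu hlu hv hlv h3 hl3 hw hlw hd wu wv w3 hbc (s1 b hb.1).2 (s1 c hc.1).2 (s1 b hb.1).1 (s1 c hc.1).1 (s2 b hb.2).1 (s2 c hc.2).1
  have i13 : (S1 ∩ S3).card ≤ 1 := by
    by_contra! h
    obtain ⟨b, hb, c, hc, hbc⟩ := Finset.one_lt_card.1 h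
    rw [Finset.mem_inter] at hb hc
    exact pair5 hG hu hlu h3 hl3 hv hlv hw hlw ((pm (l := [u,v,v3])).nodup_iff.1 hd) wu w3 wv hbc (s1 b hb.1).2 (s1 c hc.1).2 (s1 b hb.1).1 (s1 c hc.1).1 (s3 b hb.2).1 (s3 c hc.2).1
  have i23 : (S2 ∩ S3).card ≤ 1 := by
    by_contra! h
    obtain ⟨b, hb, c, hc, hbc⟩ := Finset.one_lt_card.1 h
    rw [Finset.mem_inter] at hb hc
    exact pair5 hG hv hlv h3 hl3 hu hlu hw hlw ((pm (l := [u,v,v3])).nodup_iff.1 hd) wv w3 wu hbc (s2 b hb.1).2 (s2 c hc.1).2 (s2 b hb.1).1 (s2 c hc.1).1 (s3 b hb.2).1 (s3 c hc.2).1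
  have hsub : (S1 ∪ S2) ∪ S3 ⊆ A.toFinset := by
    intro k hk
    have : G.Adj w k ∧ (G.Adj u k ∨ G.Adj v k ∨ G.Adj v3 k) := by
      simp only [Finset.mem_union] at hk
      rcases hk with (h | h) | h
      · exact ⟨(s1 k h).2, .inl (s1 k h).1⟩
      · exact ⟨(s2 k h).2, .inr (.inl (s2 k h).1)⟩
      · exact ⟨(s3 k h).2, .inr (.inr (s3 k h).1)⟩
    have hk2 := (hA.2 k).1 this.1
    have iu := G.irrefl (v := u)
    have iv := G.irrefl (v := v)
    have i3 := G.irrefl (v := v3)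
    have m1 : ¬ G.Adj v u := fun h => nuv h.symm
    have m2 : ¬ G.Adj v3 u := fun h => nu3 h.symm
    have m3 : ¬ G.Adj v3 v := fun h => nv3 h.symm
    simp only [List.mem_append, List.mem_cons, List.not_mem_nil, or_false] at hk2
    rw [List.mem_toFinset]
    rcases hk2 with (rfl | rfl | rfl) | h
    · tauto
    · tauto
    · tauto
    · exact h
  have q1 := Finset.card_le_card hsub
  have q2 := List.toFinset_card_le A
  have q3 := Finset.card_union_add_card_inter (S1 ∪ S2) S3
  have q4 := Finset.card_union_add_card_inter S1 S2
  rw [Finset.union_inter_distrib_right] at q3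
  have q5 := Finset.card_union_le (S1 ∩ S3) (S2 ∩ S3)
  simp at hlA
  omega

open Classical in
lemma nbl [Fintype V] (G : SimpleGraph V) (v : V) : 
    NB G v (G.neighborFinset v).toList ∧ (G.neighborFinset v).toList.length = G.degree v :=
  ⟨⟨Finset.nodup_toList _, fun k => by simp⟩, by simp⟩

open Classical in
lemma len_le [Fintype V] {G : SimpleGraph V} {v : V} (s : List V) (hs : s.Nodup) (h : ∀ k ∈ s, G.Adj v k) :
    s.length ≤ G.degree v := by
  obtain ⟨h1, h2⟩ := nbl G v
  obtain ⟨l, -, hl⟩ := h1.ext s hs h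
  omega

open Classical in
lemma SB.p_high [Fintype V] {G : SimpleGraph V} (hG : NoRed G) {v w x a b c p q r : V}
    (h : SB G v w x a b c p q r) : ¬ Low (G.degree p) := by
  intro hp
  have n := h.nd
  have f := h.final hG
  simp at f
  have wp : G.Adj p w := (h.hw.mp (by simp)).symm
  have := len_le (G := G) (v := p) [w,a,b,c,q,r] (by clear * - n; simp at n ⊢; grind) (by have f1 := f.1.2.2.1.symm; have f2 := f.2.1.2.1.symm; have f3 := f.2.2.1.1.symm; have f4 := f.2.2.2.1.1; have f5 := f.2.2.2.1.2; have f0 := wp.symm; simp [wp, f0, f1, f2, f3, f4, f5])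
  obtain ⟨h1, h2⟩ := nbl G p
  have := (low7 hG h1 (h2 ▸ hp) h.hw rfl wp).1
  simp at *
  omega

open Classical in
lemma SB.a_big [Fintype V] {G : SimpleGraph V} (hG : NoRed G) {v w x a b c p q r : V}
    (h : SB G v w x a b c p q r) : 8 ≤ G.degree a ∧ 
    ((G.neighborFinset a).filter (fun z => Low (G.degree z))).card + 7 ≤ G.degree a := by
  have n := h.nd
  have f := h.final hG
  simp at f
  have av : G.Adj a v := (h.hv.mp (by simp)).symm
  have aw : G.Adj a w := (h.hw.mp (by simp)).symm
  have ax := h.hax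
  refine ⟨len_le (G := G) (v := a) [v,w,b,c,x,p,q,r] (by clear * - n; simp at n ⊢; grind) (by simp [av, aw, f, ax]), ?_⟩
  have dv : G.degree v = 5 := (nbl G v).2.symm.trans ((nbl G v).1.len h.hv)
  have dw : G.degree w = 7 := (nbl G w).2.symm.trans ((nbl G w).1.len h.hw)
  have nl : ∀ z, G.Adj v z → ¬ Low (G.degree z) := by
    intro z hz hlow
    exact low_indep hG (nbl G v).1 (by rw [(nbl G v).2]; exact .inl dv) (nbl G z).1 (by rw [(nbl G z).2]; exact hlow) hz
  rw [← G.card_neighborFinset_eq_degree a, ← Finset.card_filter_add_card_filter_not (s := G.neighborFinset a) (fun z => Low (G.degree z))]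
  have : [w,b,c,x,p,q,r].toFinset ⊆ (G.neighborFinset a).filter (fun z => ¬ Low (G.degree z)) := by
    intro z hz
    rw [List.mem_toFinset] at hz
    have e1 := nl w (h.hv.mp (by simp))
    have e2 := nl b (h.hv.mp (by simp))
    have e3 := nl c (h.hv.mp (by simp))
    have e4 := nl x (h.hv.mp (by simp))
    have e5 := h.p_high hG
    have e6 := h.pq.p_high hG
    have e7 := h.qr.pq.p_high hG
    rw [Finset.mem_filter, mem_neighborFinset]
    simp only [List.mem_cons, List.not_mem_nil, or_false] at hz
    rcases hz with rfl | rfl | rfl | rfl | rfl | rfl | rfl <;> tauto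
  have h7 := Finset.card_le_card this
  rw [List.toFinset_card_of_nodup (by clear * - n; simp at n ⊢; grind)] at h7
  simp at h7
  omega

open Classical in
lemma discharge [Fintype V] (G : SimpleGraph V) (hG : NoRed G) :
    7 * (Finset.univ.filter (fun v => G.degree v ≠ 0)).card ≤ ∑ v, G.degree v := by
  set d := fun v => G.degree v with hd
  have nb : ∀ v, ∃ l, NB G v l ∧ l.length = d v := fun v => ⟨_, nbl G v⟩
  have D5 : ∀ v, d v ≠ 0 → 5 ≤ d v := by
    intro v hv
    obtain ⟨l, h1, h2⟩ := nb v
    rw [← h2] at hv ⊢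
    exact deg_ge hG h1 (by rintro rfl; simp at hv)
  have D0 : ∀ u v, G.Adj u v → d u ≠ 0 := by
    intro u v h
    have := len_le (G := G) (v := u) [v] (by simp) (by simpa using h)
    simp at this
    simp only [hd]; omega
  have LI : ∀ u v, Low (d u) → Low (d v) → ¬ G.Adj u v := by
    intro u v h1 h2
    obtain ⟨l, a1, a2⟩ := nb u
    obtain ⟨l', b1, b2⟩ := nb v
    exact low_indep hG a1 (a2 ▸ h1) b1 (b2 ▸ h2)
  have L7 : ∀ v w, Low (d v) → d w = 7 → G.Adj v w → d v = 5 ∧ ∃ x a b c p q r, SB G v w x a b c p q r := by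
    intro u v h1 h2 h
    obtain ⟨l, a1, a2⟩ := nb u
    obtain ⟨l', b1, b2⟩ := nb v
    have := low7 hG a1 (a2 ▸ h1) b1 (by omega) h
    rwa [a2] at this
  set K := fun w => (G.neighborFinset w).filter (fun z => Low (d z)) with hK
  have Kle : ∀ w, 5 ≤ d w → 2 * (K w).card + 1 ≤ d w := by
    intro w hw
    by_cases he : (K w).Nonempty
    swap
    · rw [Finset.not_nonempty_iff_eq_empty] at he
      rw [he]; simp; omega
    have := exp_aux hG w _ (K w) ((G.neighborFinset w).filter (fun z => ¬ Low (d z))) rfl he ?_ ?_ ?_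
    · have e := Finset.card_filter_add_card_filter_not (s := G.neighborFinset w) (fun z => Low (d z))
      rw [G.card_neighborFinset_eq_degree w] at e
      simp only [hK, hd] at *
      omega
    · intro i hi
      simp [hK] at hi; exact hi.1
    · intro i hi j hj
      simp [hK] at hi hj
      exact LI i j hi.2 hj.2
    · intro i hi z hz hiz
      simp [hK] at hi
      rw [Finset.mem_filter, mem_neighborFinset]
      exact ⟨hz, fun h => LI i z hi.2 h hiz⟩
  set f := fun w v : V => if (K w).card + 7 ≤ d w then 30 else if d v = 5 then 12 else 5 with hf
  set t := fun w v : V => if G.Adj w v ∧ 8 ≤ d w ∧ Low (d v) then f w v else 0 with ht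
  have outK : ∀ w, 8 ≤ d w → ∑ v, t w v = ∑ v ∈ K w, f w v := by
    intro w hw
    rw [hK]
    simp only [neighborFinset_eq_filter, Finset.filter_filter]
    rw [Finset.sum_filter]
    apply Finset.sum_congr rfl
    intro v _
    simp [ht, hw]
  have out : ∀ w, 8 ≤ d w → 210 + ∑ v, t w v ≤ 30 * d w := by
    intro w hw
    rw [outK w hw]
    have hk := Kle w (by omega)
    by_cases h1 : (K w).card + 7 ≤ d w
    · simp only [hf, h1, if_true, Finset.sum_const, smul_eq_mul]
      omega
    simp only [hf, h1, if_false]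
    by_cases h9 : 9 ≤ d w
    · have : ∑ v ∈ K w, (if d v = 5 then 12 else 5) ≤ (K w).card * 12 := by
        apply Finset.sum_le_card_nsmul
        intro v _
        split_ifs <;> simp
      omega
    · have h8 : d w = 8 := by omega
      rw [Finset.sum_ite, Finset.sum_const, Finset.sum_const]
      have e := Finset.card_filter_add_card_filter_not (s := K w) (fun z => d z = 5)
      have : ((K w).filter (fun z => d z = 5)).card ≤ 2 := by
        by_contra! hc
        obtain ⟨a, b, c, ha, hb, hc, hab, hac, hbc⟩ := Finset.two_lt_card_iff.1 hc
        simp [hK] at ha hb hc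
        obtain ⟨la, a1, a2⟩ := nb a
        obtain ⟨lb, b1, b2⟩ := nb b
        obtain ⟨lc, c1, c2⟩ := nb c
        obtain ⟨lw, w1, w2⟩ := nb w
        exact three5 hG a1 (by omega) b1 (by omega) c1 (by omega) w1 (by omega) (by simp [hab, hac, hbc]) ha.1.1 hb.1.1 hc.1.1
      simp only [smul_eq_mul]
      omega
  have out7 : ∀ w, d w < 8 → ∑ v, t w v = 0 := by
    intro w hw
    apply Finset.sum_eq_zero
    intro v _
    simp only [ht]
    rw [if_neg]
    omega
  have inN : ∀ v m, d v ≠ 0 → (∀ w, G.Adj v w → m ≤ t w v) → d v * m ≤ ∑ w, t w v := by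
    intro v m _ h
    calc d v * m = ∑ w ∈ G.neighborFinset v, m := by simp [hd]
      _ ≤ ∑ w ∈ G.neighborFinset v, t w v := Finset.sum_le_sum (fun w hw => h w (by simpa using hw))
      _ ≤ _ := Finset.sum_le_sum_of_subset (Finset.subset_univ _)
  have high : ∀ v w, Low (d v) → d w ≠ 7 → G.Adj v w → 8 ≤ d w := by
    intro v w hv hw h
    have := D5 w (D0 w v h.symm)
    have h2 : ¬ Low (d w) := fun hl => LI v w hv hl h
    unfold Low at h2
    omega
  have main : ∀ v, 210 * (if d v ≠ 0 then 1 else 0) + ∑ w, t v w ≤ 30 * d v + ∑ w, t w v := by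
    intro v
    by_cases h0 : d v = 0
    · rw [out7 v (by omega)]; simp [h0]
    rw [if_pos h0]
    have h5 := D5 v h0
    by_cases h8 : 8 ≤ d v
    · have := out v h8
      omega
    rw [out7 v (by omega)]
    by_cases h7 : d v = 7
    · omega
    by_cases h6 : d v = 6
    · have hl : Low (d v) := .inr h6
      have := inN v 5 h0 (fun w hw => by
        have h8 := high v w hl (fun h => by have := (L7 v w hl h hw).1; omega) hw
        simp only [ht, hf]
        rw [if_pos ⟨hw.symm, h8, hl⟩]
        split_ifs <;> simp)
      omega
    have h5 : d v = 5 := by omega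
    have hl : Low (d v) := .inl h5
    by_cases hb : ∃ w, G.Adj v w ∧ d w = 7
    · obtain ⟨w, hw, hw7⟩ := hb
      obtain ⟨-, x, a, b, c, p, q, r, h⟩ := L7 v w hl hw7 hw
      have e : ∀ a b c, SB G v w x a b c p q r → t a v = 30 := by
        intro a b c h
        have av : G.Adj a v := (h.hv.mp (by simp)).symm
        obtain ⟨b1, b2⟩ := h.a_big hG
        simp only [ht, hf]
        rw [if_pos ⟨av, b1, hl⟩, if_pos b2]
      have hs : ∑ k ∈ {a, b}, t k v ≤ ∑ k, t k v := Finset.sum_le_sum_of_subset (Finset.subset_univ _)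
      rw [Finset.sum_pair h.hab.ne, e _ _ _ h, e _ _ _ h.ab] at hs
      omega
    · push Not at hb
      have := inN v 12 h0 (fun w hw => by
        have h8 := high v w hl (hb w hw) hw
        simp only [ht, hf]
        rw [if_pos ⟨hw.symm, h8, hl⟩]
        split_ifs <;> simp)
      omega
  have hsum := Finset.sum_le_sum (s := Finset.univ) (fun v _ => main v)
  rw [Finset.sum_add_distrib, Finset.sum_add_distrib, Finset.sum_comm (f := fun v w => t w v), ← Finset.mul_sum, ← Finset.mul_sum, ← Finset.card_filter] at hsum
  simp only [hd] at hsum ⊢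
  omega

lemma tuza_aux [Fintype V] [DecidableEq V] (G : SimpleGraph V)
    (hmad : ∀ G' : SimpleGraph V, G' ≤ G → G'.support.Nonempty → 2 * G'.edgeSet.ncard < 7 * G'.support.ncard)  :
    ∀ G' : SimpleGraph V, G' ≤ G → triTau G' ≤ 2 * triNu G' := by
  classical
  intro G'
  induction G' using WellFoundedLT.induction with
  | ind G' ih =>
  intro hle
  by_contra hn
  have hG := noRed_of_min G' hn (fun H hH => ih H hH (hH.le.trans hle))
  have hds := discharge G' (by convert hG)
  by_cases hs : G'.support.Nonempty
  · have h1 := hmad G' hle hs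
    rw [G'.sum_degrees_eq_twice_card_edges] at hds
    have e1 : G'.edgeSet.ncard = G'.edgeFinset.card := by
      rw [← coe_edgeFinset, Set.ncard_coe_finset]
    have e2 : G'.support.ncard = (Finset.univ.filter (fun v => G'.degree v ≠ 0)).card := by
      rw [← Set.ncard_coe_finset]
      congr 1
      ext v
      simp [SimpleGraph.mem_support, ← Nat.pos_iff_ne_zero, SimpleGraph.degree_pos_iff_exists_adj]
    rw [e1, e2] at h1
    omega
  · apply hn
    have : triTau G' ≤ (∅ : Finset (Sym2 V)).card := by
      apply tau_le
      intro x y z h _ _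
      exact absurd ⟨x, (mem_support G').2 ⟨y, h⟩⟩ hs
    simp at this
    omega

/-- If `G` is a finite simple graph with maximum average degree less than 7, then
τ(G) ≤ 2ν(G). -/
theorem tuza_of_mad_lt_seven [Fintype V] [DecidableEq V] (G : SimpleGraph V)
    (hmad : ∀ H : G.Subgraph, H.verts.Nonempty →
      (2 * H.edgeSet.ncard : ℚ) / (H.verts.ncard : ℚ) < 7) :
    triTau G ≤ 2 * triNu G := by
  refine tuza_aux G (fun G' hle hs => ?_) G le_rfl
  let H : G.Subgraph :=
    { verts := G'.support
      Adj := G'.Adj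
      adj_sub := fun h => hle h
      edge_vert := fun h => ⟨_, h⟩
      symm := G'.symm }
  have hE : H.edgeSet = G'.edgeSet := by
    ext e
    induction e using Sym2.ind with
    | _ x y => rfl
  have h := hmad H hs
  have hpos : 0 < G'.support.ncard := (Set.ncard_pos (Set.toFinite _)).2 hs
  rw [hE] at h
  change (2 * (G'.edgeSet.ncard : ℚ)) / (G'.support.ncard : ℚ) < 7 at h
  rw [div_lt_iff₀ (by exact_mod_cast hpos)] at h
  exact_mod_cast h
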